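/- arXiv:2312.11766 — 8 statements merged into one kernel-verified Lean document; each statement's English description precedes it below -/
import Mathlib

section
/- Let V be a finite-dimensional complex vector space of dimension N ≥ 1 with a nondegenerate symmetric bilinear form Φ. Then Spin(V) = { v₁v₂⋯v_k : k ∈ 2ℕ, v_i ∈ V, Φ(v_i, v_i) = 1 for all 1 ≤ i ≤ k } as subsets of the Clifford algebra Cl(V); that is, an element of Cl(V) lies in Spin(V) if and only if it is a product of an even number of vectors of Φ-length 1. -/
open CliffordAlgebra

noncomputable section

/-- The Pin group of a quadratic form `Q`, following the paper: invertible homogeneous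
elements `g` of the Clifford algebra such that conjugation by `g` preserves `V ⊆ Cl(V)`
and with spinor norm `g · ι(g) = 1`, where `ι` is the reversal antiautomorphism. -/
def PinSet {V : Type*} [AddCommGroup V] [Module ℂ V] (Q : QuadraticForm ℂ V) :
    Set (CliffordAlgebra Q) :=
  {g | IsUnit g ∧ (∃ i : ZMod 2, g ∈ evenOdd Q i) ∧
    ((fun x => g * x * Ring.inverse g) '' Set.range (ι Q) = Set.range (ι Q)) ∧
    g * CliffordAlgebra.reverse g = 1}

/-- The Spin group: the intersection of the Pin group with the even part of the
Clifford algebra. -/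
def SpinSet {V : Type*} [AddCommGroup V] [Module ℂ V] (Q : QuadraticForm ℂ V) :
    Set (CliffordAlgebra Q) :=
  {g | g ∈ PinSet Q ∧ g ∈ evenOdd Q 0}

section helpers
variable {V : Type*} [AddCommGroup V] [Module ℂ V]

lemma aux_contract (Q : QuadraticForm ℂ V) (v : V) (x : CliffordAlgebra Q) :
    ι Q v * x - involute x * ι Q v = contractLeft (QuadraticMap.polarBilin Q v) x := by
  induction x using CliffordAlgebra.left_induction with
  | algebraMap r => 
    rw [contractLeft_algebraMap, AlgHom.commutes, Algebra.commutes, sub_self]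
  | add x y hx hy => rw [map_add, map_add, ← hx, ← hy]; noncomm_ring
  | ι_mul x a hx =>
    rw [contractLeft_ι_mul, ← hx, map_mul, involute_ι, QuadraticMap.polarBilin_apply_apply,
      Algebra.smul_def, ← ι_mul_ι_add_swap]
    noncomm_ring

/-- Euler operator -/
def eulerOp [FiniteDimensional ℂ V] : ExteriorAlgebra ℂ V →ₗ[ℂ] ExteriorAlgebra ℂ V :=
  ∑ i, (LinearMap.mulLeft ℂ (ExteriorAlgebra.ι ℂ (Module.finBasis ℂ V i))) ∘ₗ
    (contractLeft (Q := (0 : QuadraticForm ℂ V)) ((Module.finBasis ℂ V).coord i))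

lemma eulerOp_apply [FiniteDimensional ℂ V] (x : ExteriorAlgebra ℂ V) :
    eulerOp x = ∑ i, (ExteriorAlgebra.ι ℂ (Module.finBasis ℂ V i)) *
    (contractLeft (Q := (0 : QuadraticForm ℂ V)) ((Module.finBasis ℂ V).coord i) x) := by
  simp [eulerOp]

lemma eulerOp_ι_mul [FiniteDimensional ℂ V] (v : V) (x : ExteriorAlgebra ℂ V) :
    eulerOp (ExteriorAlgebra.ι ℂ v * x) = 
      ExteriorAlgebra.ι ℂ v * x + ExteriorAlgebra.ι ℂ v * eulerOp x := by
  rw [eulerOp_apply, eulerOp_apply]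
  have h : ∀ i, (ExteriorAlgebra.ι ℂ (Module.finBasis ℂ V i)) *
    (contractLeft (Q := (0 : QuadraticForm ℂ V)) ((Module.finBasis ℂ V).coord i) 
      (ExteriorAlgebra.ι ℂ v * x)) = 
      ExteriorAlgebra.ι ℂ ((Module.finBasis ℂ V).repr v i • Module.finBasis ℂ V i) * x + 
      ExteriorAlgebra.ι ℂ v * ((ExteriorAlgebra.ι ℂ (Module.finBasis ℂ V i)) *
    (contractLeft (Q := (0 : QuadraticForm ℂ V)) ((Module.finBasis ℂ V).coord i) x)) := by
    intro i
    have h1 := contractLeft_ι_mul (Q := (0 : QuadraticForm ℂ V)) 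
      ((Module.finBasis ℂ V).coord i) v x
    have h2 := ι_mul_ι_add_swap (Q := (0 : QuadraticForm ℂ V)) (Module.finBasis ℂ V i) v
    have h3 : ExteriorAlgebra.ι ℂ (Module.finBasis ℂ V i) * ExteriorAlgebra.ι ℂ v
      = - (ExteriorAlgebra.ι ℂ v * ExteriorAlgebra.ι ℂ (Module.finBasis ℂ V i)) := by
      rw [eq_neg_iff_add_eq_zero]
      refine h2.trans ?_
      simp [QuadraticMap.polar]
    erw [h1]
    rw [mul_sub, map_smul, smul_mul_assoc, mul_smul_comm, Module.Basis.coord_apply, 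
      sub_eq_add_neg]
    congr 1
    have h4 : ∀ z, -(ExteriorAlgebra.ι ℂ (Module.finBasis ℂ V i) * (ExteriorAlgebra.ι ℂ v * z))
      = ExteriorAlgebra.ι ℂ v * (ExteriorAlgebra.ι ℂ (Module.finBasis ℂ V i) * z) := by
      intro z
      rw [← mul_assoc, h3, neg_mul, neg_neg, mul_assoc]
    exact h4 _
  rw [Finset.sum_congr rfl fun i _ => h i, Finset.sum_add_distrib, ← Finset.sum_mul, 
    ← Finset.mul_sum, ← map_sum, Module.Basis.sum_repr]

lemma eulerOp_pow [FiniteDimensional ℂ V] (n : ℕ) (x : ExteriorAlgebra ℂ V)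
    (hx : x ∈ LinearMap.range (ExteriorAlgebra.ι ℂ (M := V)) ^ n) : eulerOp x = (n : ℂ) • x := by
  induction hx using Submodule.pow_induction_on_left' with
  | algebraMap r => 
    rw [eulerOp_apply]
    simp only [Nat.cast_zero, zero_smul]
    refine Finset.sum_eq_zero fun i _ => ?_
    erw [contractLeft_algebraMap]
    simp
  | add x y i hx hy h1 h2 => rw [map_add, h1, h2, smul_add]
  | mem_mul m hm i x hx h =>
    obtain ⟨v, rfl⟩ := hm
    rw [eulerOp_ι_mul, h, mul_smul_comm, Nat.cast_succ, add_smul, one_smul, add_comm]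

lemma aux_ext [FiniteDimensional ℂ V] (x : ExteriorAlgebra ℂ V) (hx : eulerOp x = 0) :
    ∃ c : ℂ, x = algebraMap ℂ _ c := by
  classical
  let 𝒜 := fun i : ℕ => (LinearMap.range (ExteriorAlgebra.ι ℂ (M := V)) ^ i)
  letI : GradedAlgebra 𝒜 := ExteriorAlgebra.gradedAlgebra ℂ V
  have h0 : ∀ n : ℕ, n ≠ 0 → (DirectSum.decompose 𝒜 x n : ExteriorAlgebra ℂ V) = 0 := by
    intro n hn
    have h1 : DirectSum.decompose 𝒜 (eulerOp x) n = (n : ℂ) • DirectSum.decompose 𝒜 x n := by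
      have key : ∀ y, DirectSum.decompose 𝒜 (eulerOp y) n = (n : ℂ) • DirectSum.decompose 𝒜 y n := by
        intro y
        induction y using DirectSum.Decomposition.inductionOn 𝒜 with
        | zero => simp
        | homogeneous m => 
          rename_i i
          rw [eulerOp_pow i _ m.2, DirectSum.decompose_smul, DirectSum.smul_apply,
            DirectSum.decompose_coe]
          by_cases h : i = n
          · subst h; rfl
          · rw [DirectSum.of_eq_of_ne _ _ _ (Ne.symm h)]; simp
        | add a b ha hb =>
          rw [map_add, DirectSum.decompose_add, DirectSum.decompose_add, DirectSum.add_apply, 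
            DirectSum.add_apply, ha, hb, smul_add]
      exact key x
    rw [hx, DirectSum.decompose_zero, DirectSum.zero_apply] at h1
    have h2 := (smul_eq_zero.mp h1.symm).resolve_left (by exact_mod_cast hn)
    rw [h2]; rfl
  have hs := DirectSum.sum_support_decompose 𝒜 x
  have hx0 : x = (DirectSum.decompose 𝒜 x 0 : ExteriorAlgebra ℂ V) := by
    conv_lhs => rw [← hs]
    by_cases h : 0 ∈ (DirectSum.decompose 𝒜 x).support
    · rw [Finset.sum_eq_single_of_mem 0 h fun b _ hb => h0 b hb]
    · rw [Finset.sum_eq_zero, DFinsupp.notMem_support_iff.mp h]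
      · rfl
      · intro i hi
        apply h0 i
        rintro rfl
        exact h hi
  have hm : (DirectSum.decompose 𝒜 x 0 : ExteriorAlgebra ℂ V) ∈ 𝒜 0 := (DirectSum.decompose 𝒜 x 0).2
  rw [← hx0] at hm
  simp only [𝒜, pow_zero] at hm
  obtain ⟨c, hc⟩ := Submodule.mem_one.mp hm
  exact ⟨c, hc.symm⟩

lemma aux_scalar [FiniteDimensional ℂ V] (Q : QuadraticForm ℂ V) (x : CliffordAlgebra Q)
    (hx : ∀ d : Module.Dual ℂ V, contractLeft d x = 0) :
    ∃ c : ℂ, x = algebraMap ℂ _ c := by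
  have h := changeForm.associated_neg_proof (Q := Q)
  obtain ⟨c, hc⟩ := aux_ext (changeForm h x) (by
    rw [eulerOp_apply]
    refine Finset.sum_eq_zero fun i _ => ?_
    rw [← changeForm_contractLeft, hx, map_zero, mul_zero])
  refine ⟨c, ?_⟩
  apply (changeFormEquiv h).injective
  change changeForm h x = changeForm h _
  rw [hc, changeForm_algebraMap]

end helpers

section helpers2
variable {V : Type*} [AddCommGroup V] [Module ℂ V]

local notation "QQ" => LinearMap.BilinMap.toQuadraticMap

lemma aux_swap (Φ : LinearMap.BilinForm ℂ V) (hsymm : ∀ u v : V, Φ u v = Φ v u) (a b : V) :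
    ι (QQ Φ) a * ι (QQ Φ) b + ι (QQ Φ) b * ι (QQ Φ) a = algebraMap ℂ _ (2 * Φ a b) := by
  rw [ι_mul_ι_add_swap]
  congr 1
  simp [QuadraticMap.polar, hsymm b a]
  ring

/-- image of `v` under twisted conjugation by `x` is `v'` -/
def Tw (Φ : LinearMap.BilinForm ℂ V) (x : CliffordAlgebra (QQ Φ)) (v v' : V) : Prop :=
  involute x * ι (QQ Φ) v = ι (QQ Φ) v' * x

/-- Good -/
def Good (Φ : LinearMap.BilinForm ℂ V) (x : CliffordAlgebra (QQ Φ)) : Prop :=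
  IsUnit x ∧ ∀ v, ∃ v', Tw Φ x v v'

/-- Product of a list of vectors. -/
def LP (Φ : LinearMap.BilinForm ℂ V) (l : List V) : CliffordAlgebra (QQ Φ) :=
  (l.map (ι (QQ Φ))).prod

lemma sq_unit (Φ : LinearMap.BilinForm ℂ V) {u : V} (hu : Φ u u = 1) :
    ι (QQ Φ) u * ι (QQ Φ) u = 1 := by
  rw [ι_sq_scalar, LinearMap.BilinMap.toQuadraticMap_apply, hu, map_one]

lemma isUnit_unit (Φ : LinearMap.BilinForm ℂ V) {u : V} (hu : Φ u u = 1) :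
    IsUnit (ι (QQ Φ) u) :=
  ⟨⟨_, _, sq_unit Φ hu, sq_unit Φ hu⟩, rfl⟩

lemma Tw_unit (Φ : LinearMap.BilinForm ℂ V) (hsymm : ∀ u v : V, Φ u v = Φ v u)
    {u : V} (hu : Φ u u = 1) (x : CliffordAlgebra (QQ Φ)) {v v' : V} (h : Tw Φ x v v') :
    Tw Φ (ι (QQ Φ) u * x) v (v' - (2 * Φ u v') • u) := by
  unfold Tw at *
  rw [map_mul, mul_assoc, h, involute_ι, map_sub, map_smul, sub_mul, smul_mul_assoc, ← mul_assoc 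
    (ι (QQ Φ) u), sq_unit Φ hu, one_mul, Algebra.smul_def, ← aux_swap Φ hsymm]
  noncomm_ring

lemma Good_unit (Φ : LinearMap.BilinForm ℂ V) (hsymm : ∀ u v : V, Φ u v = Φ v u)
    {u : V} (hu : Φ u u = 1) {x : CliffordAlgebra (QQ Φ)} (h : Good Φ x) :
    Good Φ (ι (QQ Φ) u * x) :=
  ⟨(isUnit_unit Φ hu).mul h.1, fun v => let ⟨_, h'⟩ := h.2 v; ⟨_, Tw_unit Φ hsymm hu x h'⟩⟩

lemma Tw_vec (Φ : LinearMap.BilinForm ℂ V) (hsymm : ∀ u v : V, Φ u v = Φ v u)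
    {a : V} (ha : Φ a a ≠ 0) : ∃ u, Φ u u = 1 ∧ 
      ∀ (x : CliffordAlgebra (QQ Φ)) {v v' : V} (h : Tw Φ x v v'),
    Tw Φ (ι (QQ Φ) u * x) v (v' - (2 * Φ a v' / Φ a a) • a) := by
  obtain ⟨c, hc⟩ := IsAlgClosed.exists_pow_nat_eq (Φ a a) (n := 2) (by norm_num)
  have hc0 : c ≠ 0 := by rintro rfl; apply ha; rw [← hc]; simp
  have hu : Φ (c⁻¹ • a) (c⁻¹ • a) = 1 := by
    simp [← hc]; field_simp
  refine ⟨c⁻¹ • a, hu, fun x v v' h => ?_⟩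
  have := Tw_unit Φ hsymm hu x h
  convert this using 2
  rw [smul_smul, ← hc]
  congr 1
  simp
  field_simp

lemma Tw_isom (Φ : LinearMap.BilinForm ℂ V) 
    {x : CliffordAlgebra (QQ Φ)} (hx : IsUnit x) {v v' : V} (h : Tw Φ x v v') :
    Φ v' v' = Φ v v := by
  unfold Tw at h
  have h2 := congrArg involute h
  rw [map_mul, map_mul, involute_involute, involute_ι, involute_ι, mul_neg, neg_mul, neg_inj] at h2
  have h3 : algebraMap ℂ (CliffordAlgebra (QQ Φ)) (Φ v' v') * x = algebraMap ℂ _ (Φ v v) * x := by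
    have e1 := ι_sq_scalar (QQ Φ) v'
    have e2 := ι_sq_scalar (QQ Φ) v
    rw [LinearMap.BilinMap.toQuadraticMap_apply] at e1 e2
    rw [← e1, mul_assoc, ← h, ← mul_assoc, ← h2, mul_assoc, e2, Algebra.commutes]
  exact (algebraMap ℂ (CliffordAlgebra (QQ Φ))).injective (hx.mul_right_cancel h3)

lemma Tw_add (Φ : LinearMap.BilinForm ℂ V) {x : CliffordAlgebra (QQ Φ)} {v v' w w' : V} 
    (h : Tw Φ x v v') (h2 : Tw Φ x w w') : Tw Φ x (v + w) (v' + w') := by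
  unfold Tw at *
  rw [map_add, map_add, mul_add, add_mul, h, h2]

lemma Tw_inner (Φ : LinearMap.BilinForm ℂ V) (hsymm : ∀ u v : V, Φ u v = Φ v u)
    {x : CliffordAlgebra (QQ Φ)} (hx : IsUnit x) {v v' w w' : V} (h : Tw Φ x v v')
    (h2 : Tw Φ x w w') : Φ v' w' = Φ v w := by
  have a1 := Tw_isom Φ hx h
  have a2 := Tw_isom Φ hx h2
  have a3 := Tw_isom Φ hx (Tw_add Φ h h2)
  simp only [map_add, LinearMap.add_apply, hsymm w v, hsymm w' v'] at a3
  linear_combination (a3 - a1 - a2) / 2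

lemma main_ind {I : Type*} [Fintype I] (Φ : LinearMap.BilinForm ℂ V) 
    (hsymm : ∀ u v : V, Φ u v = Φ v u) (b : I → V) (hb : ∀ i j, i ≠ j → Φ (b i) (b j) = 0)
    (hb0 : ∀ i, Φ (b i) (b i) ≠ 0) (x : CliffordAlgebra (QQ Φ)) (hx : Good Φ x) (s : Finset I) :
    ∃ l : List V, (∀ u ∈ l, Φ u u = 1) ∧ Good Φ (LP Φ l * x) ∧ 
      ∀ i ∈ s, Tw Φ (LP Φ l * x) (b i) (b i) := by
  classical
  induction s using Finset.induction_on with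
  | empty => exact ⟨[], by simp, by simpa [LP] using hx, by simp⟩
  | insert j s hj ih =>
    obtain ⟨l, hl, hg, hf⟩ := ih
    set y := LP Φ l * x with hy
    obtain ⟨w, hw⟩ := hg.2 (b j)
    have hw1 := Tw_isom Φ hg.1 hw
    have hw2 : ∀ i ∈ s, Φ w (b i) = 0 := fun i hi => by
      rw [Tw_inner Φ hsymm hg.1 hw (hf i hi)]
      exact hb _ _ (by rintro rfl; exact hj hi)
    have hw3 : ∀ i ∈ s, Φ (b j) (b i) = 0 := fun i hi => hb _ _ (by rintro rfl; exact hj hi)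
    by_cases hA : Φ (w - b j) (w - b j) = 0
    · have hA' := hA
      simp only [map_sub, LinearMap.sub_apply, hsymm (b j) w] at hA'
      have hB : Φ (w + b j) (w + b j) ≠ 0 := by
        intro h
        simp only [map_add, LinearMap.add_apply, hsymm (b j) w] at h
        apply hb0 j
        linear_combination (hA' + h - 2 * hw1) / 4
      obtain ⟨u, hu, hT⟩ := Tw_vec Φ hsymm hB
      obtain ⟨u', hu', hT'⟩ := Tw_vec Φ hsymm (hb0 j)
      refine ⟨u' :: u :: l, by simpa [hu, hu'] using hl, ?_, ?_⟩
      · have := Good_unit Φ hsymm hu' (Good_unit Φ hsymm hu hg)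
        simpa [LP, hy, mul_assoc] using this
      · intro i hi
        have key : Tw Φ (ι (QQ Φ) u' * (ι (QQ Φ) u * y)) (b i) (b i) := by
          rcases Finset.mem_insert.mp hi with rfl | hi
          · convert hT' _ (hT _ hw) using 1
            have e : 2 * Φ (w + b i) w / Φ (w + b i) (w + b i) = 1 := by
              rw [div_eq_one_iff_eq hB]
              simp only [map_add, LinearMap.add_apply, hsymm (b i) w]
              linear_combination hw1
            have e2 : 2 * Φ (b i) (- b i) / Φ (b i) (b i) = -2 := by
              have := hb0 i
              rw [map_neg]; field_simp
            have e3 : w - (w + b i) = - b i := by abel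
            rw [e, one_smul, e3, e2]
            module
          · convert hT' _ (hT _ (hf i hi)) using 1
            simp [hw2 i hi, hw3 i hi]
        simpa [LP, hy, mul_assoc] using key
    · obtain ⟨u, hu, hT⟩ := Tw_vec Φ hsymm hA
      refine ⟨u :: l, by simpa [hu] using hl, ?_, ?_⟩
      · have := (Good_unit Φ hsymm hu hg)
        simpa [LP, hy, mul_assoc] using this
      · intro i hi
        have key : Tw Φ ((ι (QQ Φ) u * y)) (b i) (b i) := by
          rcases Finset.mem_insert.mp hi with rfl | hi
          · convert (hT _ hw) using 1
            have e : 2 * Φ (w - b i) w / Φ (w - b i) (w - b i) = 1 := by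
              rw [div_eq_one_iff_eq hA]
              simp only [map_sub, LinearMap.sub_apply, hsymm (b i) w]
              linear_combination hw1
            rw [e, one_smul]
            abel
          · convert (hT _ (hf i hi)) using 1
            simp [hw2 i hi, hw3 i hi]
        simpa [LP, hy, mul_assoc] using key

lemma exists_basis [FiniteDimensional ℂ V] (Φ : LinearMap.BilinForm ℂ V) 
    (hsymm : ∀ u v : V, Φ u v = Φ v u)
    (hnd : ∀ u : V, (∀ v : V, Φ u v = 0) → u = 0) :
    ∃ b : Module.Basis (Fin (Module.finrank ℂ V)) ℂ V, 
     (∀ i j, i ≠ j → Φ (b i) (b j) = 0) ∧ (∀ i, Φ (b i) (b i) ≠ 0) := by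
  obtain ⟨b, hb⟩ := LinearMap.BilinForm.exists_orthogonal_basis (B := Φ) ⟨fun u v => hsymm u v⟩
  have h1 : ∀ i j, i ≠ j → Φ (b i) (b j) = 0 := fun i j hij => hb hij
  refine ⟨b, h1, fun i h => b.ne_zero i (hnd _ fun v => ?_)⟩
  have : Φ (b i) = 0 := b.ext fun j => by
    by_cases hij : i = j
    · subst hij; simpa using h
    · simpa using h1 i j hij
  rw [this]; rfl

lemma good_decomp [FiniteDimensional ℂ V] (Φ : LinearMap.BilinForm ℂ V) 
    (hsymm : ∀ u v : V, Φ u v = Φ v u)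
    (hnd : ∀ u : V, (∀ v : V, Φ u v = 0) → u = 0) (x : CliffordAlgebra (QQ Φ)) (hx : Good Φ x) :
    ∃ l : List V, (∀ u ∈ l, Φ u u = 1) ∧ ∃ c : ℂ, LP Φ l * x = algebraMap ℂ _ c := by
  obtain ⟨b, hb, hb0⟩ := exists_basis Φ hsymm hnd
  obtain ⟨l, hl, hg, hf⟩ := main_ind Φ hsymm b hb hb0 x hx Finset.univ
  refine ⟨l, hl, aux_scalar _ _ fun d => ?_⟩
  set y := LP Φ l * x
  have h1 : ∀ v, contractLeft (QuadraticMap.polarBilin (QQ Φ) v) y = 0 := by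
    intro v
    have : (contractLeft (Q := QQ Φ)).flip y ∘ₗ QuadraticMap.polarBilin (QQ Φ) = 0 := by
      refine b.ext fun i => ?_
      have := hf i (Finset.mem_univ _)
      unfold Tw at this
      simp only [LinearMap.comp_apply, LinearMap.flip_apply, ← aux_contract, this, sub_self]
      rfl
    exact LinearMap.congr_fun this v
  have hs : Function.Surjective (QuadraticMap.polarBilin (QQ Φ)) := by
    have hd : Module.finrank ℂ V = Module.finrank ℂ (Module.Dual ℂ V) := 
      Subspace.dual_finrank_eq.symm
    apply (LinearMap.injective_iff_surjective_of_finrank_eq_finrank hd).mp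
    rw [injective_iff_map_eq_zero]
    intro u hu
    apply hnd u
    intro v
    have := LinearMap.congr_fun hu v
    simp [QuadraticMap.polar, hsymm v u] at this
    linear_combination this / 2
  obtain ⟨v, rfl⟩ := hs d
  exact h1 v

lemma LP_rev (Φ : LinearMap.BilinForm ℂ V) (l : List V) : reverse (LP Φ l) = LP Φ l.reverse := by
  unfold LP
  rw [reverse_prod_map_ι, List.map_reverse]

lemma LP_append (Φ : LinearMap.BilinForm ℂ V) (l l' : List V) : 
    LP Φ (l ++ l') = LP Φ l * LP Φ l' := by
  simp [LP]

lemma LP_cons (Φ : LinearMap.BilinForm ℂ V) (u) (l : List V) : 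
    LP Φ (u :: l) = ι (QQ Φ) u * LP Φ l := by
  simp [LP]

lemma LP_rev_mul (Φ : LinearMap.BilinForm ℂ V) (l : List V) (hl : ∀ u ∈ l, Φ u u = 1) :
    reverse (LP Φ l) * LP Φ l = 1 := by
  induction l with
  | nil => simp [LP]
  | cons u l ih =>
    rw [LP_cons, reverse.map_mul, reverse_ι, mul_assoc, ← mul_assoc (ι (QQ Φ) u), 
      sq_unit Φ (hl u (by simp)), one_mul, ih fun v hv => hl v (by simp [hv])]

lemma LP_mul_rev (Φ : LinearMap.BilinForm ℂ V) (l : List V) (hl : ∀ u ∈ l, Φ u u = 1) :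
    LP Φ l * reverse (LP Φ l) = 1 := by
  have := LP_rev_mul Φ l.reverse (by simpa using hl)
  rwa [← LP_rev, reverse_reverse] at this

lemma LP_mem (Φ : LinearMap.BilinForm ℂ V) (l : List V) :
    LP Φ l ∈ evenOdd (QQ Φ) (l.length : ZMod 2) := by
  induction l with
  | nil => simpa [LP] using SetLike.GradedOne.one_mem (A := evenOdd (QQ Φ))
  | cons u l ih =>
    rw [LP_cons, List.length_cons, Nat.cast_succ, add_comm]
    exact SetLike.GradedMul.mul_mem (ι_mem_evenOdd_one _ u) ih

lemma LP_good (Φ : LinearMap.BilinForm ℂ V) (hsymm : ∀ u v : V, Φ u v = Φ v u) 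
    (l : List V) (hl : ∀ u ∈ l, Φ u u = 1) : Good Φ (LP Φ l) := by
  induction l with
  | nil => exact ⟨by simp [LP], fun v => ⟨v, by simp [Tw, LP]⟩⟩
  | cons u l ih =>
    rw [LP_cons]
    exact Good_unit Φ hsymm (hl u (by simp)) (ih fun v hv => hl v (by simp [hv]))

lemma LP_ofFn (Φ : LinearMap.BilinForm ℂ V) {n : ℕ} (v : Fin n → V) :
    (List.ofFn fun i => ι (QQ Φ) (v i)).prod = LP Φ (List.ofFn v) := by
  unfold LP
  rw [List.map_ofFn]; rfl

lemma LP_even_set (Φ : LinearMap.BilinForm ℂ V) (l : List V) (hl : ∀ u ∈ l, Φ u u = 1) 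
    (he : Even l.length) : ∃ (k : ℕ) (v : Fin (2 * k) → V), (∀ i, Φ (v i) (v i) = 1) ∧
        LP Φ l = (List.ofFn fun i => ι (QQ Φ) (v i)).prod := by
  obtain ⟨k, hk⟩ := he
  have hk : l.length = 2 * k := by omega
  refine ⟨k, fun i => l.get (i.cast hk.symm), fun i => hl _ (List.get_mem _ _), ?_⟩
  rw [LP_ofFn]
  congr 1
  apply List.ext_get
  · simp [hk]
  · intro n h1 h2
    simp

end helpers2

/-- An element of the Clifford algebra of a nondegenerate symmetric bilinear form on a
complex vector space of dimension at least one lies in the Spin group if and only if it is a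
product of an even number of vectors of length one. -/
theorem statement1 {V : Type*} [AddCommGroup V] [Module ℂ V] [FiniteDimensional ℂ V]
    (hdim : 1 ≤ Module.finrank ℂ V)
    (Φ : LinearMap.BilinForm ℂ V)
    (hsymm : ∀ u v : V, Φ u v = Φ v u)
    (hnd : ∀ u : V, (∀ v : V, Φ u v = 0) → u = 0) :
    SpinSet (LinearMap.BilinMap.toQuadraticMap Φ) =
      {g | ∃ (k : ℕ) (v : Fin (2 * k) → V), (∀ i, Φ (v i) (v i) = 1) ∧
        g = (List.ofFn fun i => ι (LinearMap.BilinMap.toQuadraticMap Φ) (v i)).prod} := by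
  ext g
  constructor
  · rintro ⟨⟨hu, -, hconj, hrev⟩, heven⟩
    have hinv := involute_eq_of_mem_even heven
    have hgood : Good Φ g := by
      refine ⟨hu, fun v => ?_⟩
      have : g * ι (LinearMap.BilinMap.toQuadraticMap Φ) v * Ring.inverse g ∈
          Set.range (ι (LinearMap.BilinMap.toQuadraticMap Φ)) := by
        rw [← hconj]; exact ⟨_, ⟨v, rfl⟩, rfl⟩
      obtain ⟨v', hv'⟩ := this
      refine ⟨v', ?_⟩
      unfold Tw
      rw [hv', hinv, mul_assoc _ _ g, Ring.inverse_mul_cancel _ hu, mul_one]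
    obtain ⟨l, hl, c, hc⟩ := good_decomp Φ hsymm hnd g hgood
    have hg : g = algebraMap ℂ _ c * LP Φ l.reverse := by
      rw [Algebra.commutes, ← hc, ← mul_assoc, ← LP_rev, LP_rev_mul Φ l hl, one_mul]
    have hlr : ∀ u ∈ l.reverse, Φ u u = 1 := by simpa using hl
    generalize l.reverse = m at hg hlr
    have hc2 : c * c = 1 := by
      apply (algebraMap ℂ (CliffordAlgebra (LinearMap.BilinMap.toQuadraticMap Φ))).injective
      rw [map_one, ← hrev, hg, reverse.map_mul, reverse.commutes, mul_assoc, 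
        ← mul_assoc _ _ (algebraMap _ _ c), LP_mul_rev Φ m hlr, one_mul, map_mul]
    have hev : Even m.length := by
      by_contra hodd
      rw [Nat.not_even_iff_odd] at hodd
      have h1 := LP_mem Φ m
      rw [ZMod.natCast_eq_one_iff_odd.mpr hodd] at h1
      have h2 : g ∈ evenOdd (LinearMap.BilinMap.toQuadraticMap Φ) 1 := by
        rw [hg, ← Algebra.smul_def]
        exact Submodule.smul_mem _ _ h1
      have := Submodule.disjoint_def.mp 
        (evenOdd_isCompl (LinearMap.BilinMap.toQuadraticMap Φ)).disjoint g heven h2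
      rw [this] at hu
      exact not_isUnit_zero hu
    rcases mul_self_eq_one_iff.mp hc2 with rfl | rfl
    · rw [map_one, one_mul] at hg
      rw [hg]
      exact LP_even_set Φ m hlr hev
    · obtain ⟨b, -, hb0⟩ := exists_basis Φ hsymm hnd
      obtain ⟨u, hu1, -⟩ := Tw_vec Φ hsymm (hb0 ⟨0, hdim⟩)
      have : g = LP Φ (u :: (-u) :: m) := by
        rw [hg, LP_cons, LP_cons, map_neg, map_neg, map_one, ← mul_assoc, mul_neg, sq_unit Φ hu1]
      rw [this]
      refine LP_even_set Φ _ ?_ ?_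
      · simpa [hu1] using hlr
      · rw [List.length_cons, List.length_cons, add_assoc]
        exact hev.add (by decide)
  · rintro ⟨k, v, hv, rfl⟩
    rw [LP_ofFn]
    have hlen : (List.ofFn v).length = 2 * k := by simp
    have hl : ∀ u ∈ List.ofFn v, Φ u u = 1 := by
      intro u hu
      obtain ⟨i, rfl⟩ := (List.mem_ofFn' _ _).mp hu
      exact hv i
    generalize List.ofFn v = l at hlen hl
    have hG := LP_good Φ hsymm l hl
    have hmem : LP Φ l ∈ evenOdd (LinearMap.BilinMap.toQuadraticMap Φ) 0 := by
      have := LP_mem Φ l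
      rwa [hlen, ZMod.natCast_eq_zero_iff_even.mpr (even_two_mul k)] at this
    have hG' := LP_good Φ hsymm l.reverse (by simpa using hl)
    have hmem' : LP Φ l.reverse ∈ evenOdd (LinearMap.BilinMap.toQuadraticMap Φ) 0 := by
      have := LP_mem Φ l.reverse
      rwa [List.length_reverse, hlen, ZMod.natCast_eq_zero_iff_even.mpr (even_two_mul k)] at this
    have hinv : Ring.inverse (LP Φ l) = LP Φ l.reverse := by
      rw [← LP_rev]
      exact Ring.inverse_unit ⟨_, _, LP_mul_rev Φ l hl, LP_rev_mul Φ l hl⟩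
    have m1 : LP Φ l * LP Φ l.reverse = 1 := by rw [← LP_rev]; exact LP_mul_rev Φ l hl
    have m2 : LP Φ l.reverse * LP Φ l = 1 := by rw [← LP_rev]; exact LP_rev_mul Φ l hl
    refine ⟨⟨hG.1, ⟨0, hmem⟩, ?_, LP_mul_rev Φ l hl⟩, hmem⟩
    rw [hinv]
    apply Set.Subset.antisymm
    · rintro _ ⟨_, ⟨v, rfl⟩, rfl⟩
      obtain ⟨v', hv'⟩ := hG.2 v
      unfold Tw at hv'
      rw [involute_eq_of_mem_even hmem] at hv'
      refine ⟨v', ?_⟩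
      simp only
      rw [hv', mul_assoc, m1, mul_one]
    · rintro _ ⟨v, rfl⟩
      obtain ⟨v', hv'⟩ := hG'.2 v
      unfold Tw at hv'
      rw [involute_eq_of_mem_even hmem'] at hv'
      refine ⟨_, ⟨v', rfl⟩, ?_⟩
      simp only
      rw [mul_assoc, ← hv', ← mul_assoc, m1, one_mul]

end
end

section
/- Let V be a finite-dimensional complex vector space of dimension N ≥ 1 with a nondegenerate symmetric bilinear form Φ. For every linear automorphism f of V satisfying Φ(f(u), f(v)) = Φ(u, v) for all u, v ∈ V, there exists g ∈ Pin(V) such that f(v) = (−1)^{deg g} g v g⁻¹ for all v ∈ V. That is, the homomorphism p : Pin(V) → O(V) is surjective. -/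
open CliffordAlgebra

noncomputable section

def PinP {V : Type*} [AddCommGroup V] [Module ℂ V] (Q : QuadraticForm ℂ V) (f : V → V) : Prop :=
  ∃ (g : CliffordAlgebra Q) (d : ZMod 2), g ∈ evenOdd Q d ∧ g * CliffordAlgebra.reverse g = 1 ∧
    CliffordAlgebra.reverse g * g = 1 ∧
    ∀ v, ι Q (f v) = ((-1 : ℂ) ^ d.val) • (g * ι Q v * CliffordAlgebra.reverse g)

theorem PinP_id {V : Type*} [AddCommGroup V] [Module ℂ V] (Q : QuadraticForm ℂ V) (f : V → V)
    (hf : ∀ v, f v = v) : PinP Q f := by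
  refine ⟨1, 0, SetLike.one_mem_graded (evenOdd Q), by simp, by simp, fun v => by simp [hf]⟩

theorem neg_one_pow_zmod (d e : ZMod 2) :
    (-1 : ℂ) ^ (d + e).val = (-1) ^ d.val * (-1) ^ e.val := by
  rw [ZMod.val_add, ← neg_one_pow_eq_pow_mod_two, pow_add]

theorem PinP_comp {V : Type*} [AddCommGroup V] [Module ℂ V] (Q : QuadraticForm ℂ V) (f h k : V → V)
    (hf : PinP Q f) (hh : PinP Q h) (hk : ∀ v, k v = f (h v)) : PinP Q k := by
  obtain ⟨g, d, h1, h2, h3, h4⟩ := hf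
  obtain ⟨g', e, h1', h2', h3', h4'⟩ := hh
  refine ⟨g * g', d + e, SetLike.mul_mem_graded h1 h1', ?_, ?_, fun v => ?_⟩
  · rw [reverse.map_mul, mul_assoc, ← mul_assoc g', h2', one_mul, h2]
  · rw [reverse.map_mul, mul_assoc, ← mul_assoc _ g, h3, one_mul, h3']
  · rw [hk, h4, h4', neg_one_pow_zmod, reverse.map_mul]
    simp only [mul_smul_comm, smul_mul_assoc, smul_smul, mul_assoc]

def reflMap {V : Type*} [AddCommGroup V] [Module ℂ V] (Φ : LinearMap.BilinForm ℂ V) (u : V) :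
    V →ₗ[ℂ] V := LinearMap.id - (2 / Φ u u) • (Φ u).smulRight u

theorem reflMap_apply {V : Type*} [AddCommGroup V] [Module ℂ V] (Φ : LinearMap.BilinForm ℂ V)
    (u x : V) : reflMap Φ u x = x - (2 / Φ u u * Φ u x) • u := by
  simp [reflMap, smul_smul]

theorem reflMap_isom {V : Type*} [AddCommGroup V] [Module ℂ V] (Φ : LinearMap.BilinForm ℂ V)
    (hsymm : ∀ u v : V, Φ u v = Φ v u) (u : V) (hu : Φ u u ≠ 0) (x y : V) :
    Φ (reflMap Φ u x) (reflMap Φ u y) = Φ x y := by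
  simp only [reflMap_apply, map_sub, LinearMap.sub_apply, map_smul, LinearMap.smul_apply,
    smul_eq_mul]
  rw [hsymm x u]
  field_simp
  ring

theorem reflMap_invol {V : Type*} [AddCommGroup V] [Module ℂ V] (Φ : LinearMap.BilinForm ℂ V)
    (u : V) (hu : Φ u u ≠ 0) (x : V) :
    reflMap Φ u (reflMap Φ u x) = x := by
  rw [reflMap_apply, reflMap_apply]
  simp only [map_sub, map_smul, smul_eq_mul]
  rw [sub_sub, ← add_smul]
  have : (2 / Φ u u * Φ u x + 2 / Φ u u * (Φ u x - 2 / Φ u u * Φ u x * Φ u u)) = 0 := by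
    field_simp
    ring
  rw [this, zero_smul, sub_zero]

theorem PinP_refl {V : Type*} [AddCommGroup V] [Module ℂ V] (Φ : LinearMap.BilinForm ℂ V)
    (hsymm : ∀ u v : V, Φ u v = Φ v u) (u : V) (hu : Φ u u ≠ 0) :
    PinP (LinearMap.BilinMap.toQuadraticMap Φ) (reflMap Φ u) := by
  obtain ⟨c, hc⟩ := IsAlgClosed.exists_pow_nat_eq (Φ u u)⁻¹ (n := 2) (by norm_num)
  set Q := LinearMap.BilinMap.toQuadraticMap Φ with hQ
  have hsq : ι Q u * ι Q u = algebraMap ℂ _ (Φ u u) := by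
    rw [ι_sq_scalar]; simp [hQ]
  have hrev : CliffordAlgebra.reverse (c • ι Q u) = c • ι Q u := by
    rw [map_smul, reverse_ι]
  have h1 : (c • ι Q u) * (c • ι Q u) = 1 := by
    rw [smul_mul_smul_comm, hsq, ← pow_two, hc, Algebra.smul_def, ← map_mul, inv_mul_cancel₀ hu, map_one]
  refine ⟨c • ι Q u, 1, Submodule.smul_mem _ _ (ι_mem_evenOdd_one Q u), ?_, ?_, fun x => ?_⟩
  · rw [hrev, h1]
  · rw [hrev, h1]
  · rw [hrev]
    have h2 : ι Q u * ι Q x * ι Q u = (2 * Φ u x) • ι Q u - (Φ u u) • ι Q x := by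
      have h3 : ι Q u * ι Q x = algebraMap ℂ _ (2 * Φ u x) - ι Q x * ι Q u := by
        rw [eq_sub_iff_add_eq, ι_mul_ι_add_swap]
        congr 1
        simp [QuadraticMap.polar, hQ, hsymm x u]
        ring
      rw [h3, sub_mul, mul_assoc, hsq, Algebra.smul_def, Algebra.smul_def, Algebra.commutes (Φ u u)]
    rw [smul_mul_assoc, smul_mul_assoc, mul_smul_comm, h2, smul_smul c c, ← pow_two, hc,
      reflMap_apply, map_sub, map_smul, smul_sub, smul_smul, smul_smul, inv_mul_cancel₀ hu]
    have : (1 : ZMod 2).val = 1 := rfl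
    rw [this, pow_one, neg_one_smul, neg_sub, one_smul]
    congr 2
    field_simp

theorem PinP_main {V : Type*} [AddCommGroup V] [Module ℂ V]
    (Φ : LinearMap.BilinForm ℂ V) (hsymm : ∀ u v : V, Φ u v = Φ v u)
    {n : Type*} [DecidableEq n] (b : Module.Basis n ℂ V) (ho : ∀ i j, i ≠ j → Φ (b i) (b j) = 0)
    (hb : ∀ i, Φ (b i) (b i) ≠ 0) (S : Finset n) :
    ∀ f : V →ₗ[ℂ] V, (∀ u v : V, Φ (f u) (f v) = Φ u v) → (∀ i, i ∉ S → f (b i) = b i) →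
      PinP (LinearMap.BilinMap.toQuadraticMap Φ) f := by
  induction S using Finset.induction_on with
  | empty =>
    intro f _ h
    apply PinP_id
    intro v
    have : f = LinearMap.id := b.ext (fun i => by simpa using h i)
    simp [this]
  | insert a S ha ih =>
    intro f hf h
    have hort : ∀ i, i ∉ insert a S → Φ (f (b a)) (b i) = 0 := by
      intro i hi
      have hia : a ≠ i := by rintro rfl; simp at hi
      rw [← h i hi, hf, ho a i hia]
    have hort' : ∀ i, i ∉ insert a S → Φ (b a) (b i) = 0 := by
      intro i hi
      have hia : a ≠ i := by rintro rfl; simp at hi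
      rw [ho a i hia]
    have hn := hf (b a) (b a)
    have hba := hb a
    by_cases hc : Φ (f (b a) - b a) (f (b a) - b a) ≠ 0
    · set u := f (b a) - b a with hu
      refine PinP_comp _ (reflMap Φ u) (reflMap Φ u ∘ₗ f) _ (PinP_refl Φ hsymm u hc)
        (ih _ ?_ ?_) ?_
      · intro x y
        simp [reflMap_isom Φ hsymm u hc, hf]
      · intro i hi
        rw [LinearMap.comp_apply, reflMap_apply]
        by_cases hia : i = a
        · subst hia
          have h1 : 2 / Φ u u * Φ u (f (b i)) = 1 := by
            have : Φ u u = 2 * Φ u (f (b i)) := by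
              simp [hu, hn, hsymm (b i) (f (b i))]; ring
            rw [div_mul_eq_mul_div, ← this, div_self hc]
          rw [h1, one_smul, hu, sub_sub_cancel]
        · have hi' : i ∉ insert a S := by simp [hia, hi]
          rw [h i hi']
          simp [hu, hort i hi', hort' i hi']
      · intro v
        simp [reflMap_invol Φ u hc]
    · push Not at hc
      set u := f (b a) + b a with hu
      have hc' : Φ u u ≠ 0 := by
        intro h0
        apply hba
        simp [hu, hn, hsymm (b a) (f (b a))] at h0 hc
        linear_combination (h0 + hc) / 4
      refine PinP_comp _ (reflMap Φ u) (reflMap Φ u ∘ₗ f) _ (PinP_refl Φ hsymm u hc') ?_ ?_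
      · refine PinP_comp _ (reflMap Φ (b a)) (reflMap Φ (b a) ∘ₗ reflMap Φ u ∘ₗ f) _
          (PinP_refl Φ hsymm _ hba) (ih _ ?_ ?_) ?_
        · intro x y
          simp [reflMap_isom Φ hsymm u hc', reflMap_isom Φ hsymm _ hba, hf]
        · intro i hi
          rw [LinearMap.comp_apply, LinearMap.comp_apply, reflMap_apply Φ u]
          by_cases hia : i = a
          · subst hia
            have h1 : 2 / Φ u u * Φ u (f (b i)) = 1 := by
              have : Φ u u = 2 * Φ u (f (b i)) := by
                simp [hu, hn, hsymm (b i) (f (b i))]; ring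
              rw [div_mul_eq_mul_div, ← this, div_self hc']
            rw [h1, one_smul, hu, sub_add_cancel_left, map_neg, reflMap_apply,
              div_mul_cancel₀ _ hba, two_smul]
            abel
          · have hi' : i ∉ insert a S := by simp [hia, hi]
            rw [h i hi']
            simp [hu, hort i hi', hort' i hi', reflMap_apply]
        · intro v
          simp [reflMap_invol Φ _ hba]
      · intro v
        simp [reflMap_invol Φ u hc']

/-- Every isometry of a nondegenerate symmetric bilinear form on a complex vector space of
dimension at least one is of the form `v ↦ (−1)^{deg g} g v g⁻¹` for some `g ∈ Pin(V)`;
i.e. the homomorphism `p : Pin(V) → O(V)` is surjective. -/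
theorem statement6 {V : Type*} [AddCommGroup V] [Module ℂ V] [FiniteDimensional ℂ V]
    (hdim : 1 ≤ Module.finrank ℂ V)
    (Φ : LinearMap.BilinForm ℂ V)
    (hsymm : ∀ u v : V, Φ u v = Φ v u)
    (hnd : ∀ u : V, (∀ v : V, Φ u v = 0) → u = 0)
    (f : V ≃ₗ[ℂ] V) (hf : ∀ u v : V, Φ (f u) (f v) = Φ u v) :
    ∃ g ∈ PinSet (LinearMap.BilinMap.toQuadraticMap Φ), ∃ d : ZMod 2,
      g ∈ evenOdd (LinearMap.BilinMap.toQuadraticMap Φ) d ∧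
      ∀ v : V, ι (LinearMap.BilinMap.toQuadraticMap Φ) (f v) =
        ((-1 : ℂ) ^ d.val) •
          (g * ι (LinearMap.BilinMap.toQuadraticMap Φ) v * Ring.inverse g) := by
  classical
  have hS : LinearMap.IsSymm Φ := ⟨fun u v => by simpa using hsymm u v⟩
  have hN : Φ.Nondegenerate := by
    refine ⟨fun u hu => hnd u hu, fun u hu => hnd u fun v => ?_⟩
    rw [hsymm]; exact hu v
  obtain ⟨b, hb⟩ := LinearMap.BilinForm.exists_orthogonal_basis hS
  have hbb := LinearMap.IsOrthoᵢ.not_isOrtho_basis_self_of_separatingLeft hb hN.1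
  obtain ⟨g, d, h1, h2, h3, h4⟩ := PinP_main Φ hsymm b (fun i j hij => hb hij) hbb Finset.univ
    f.toLinearMap hf (by simp)
  have hinv : Ring.inverse g = CliffordAlgebra.reverse g :=
    Ring.inverse_unit (⟨g, _, h2, h3⟩ : (CliffordAlgebra _)ˣ)
  have hs : ((-1 : ℂ) ^ d.val) * ((-1 : ℂ) ^ d.val) = 1 := by
    rw [← mul_pow]; simp
  refine ⟨g, ⟨⟨⟨g, _, h2, h3⟩, rfl⟩, ⟨d, h1⟩, ?_, h2⟩, d, h1, ?_⟩
  · rw [hinv]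
    have key : ∀ v, g * ι (LinearMap.BilinMap.toQuadraticMap Φ) v * CliffordAlgebra.reverse g =
        ι _ (f (((-1 : ℂ) ^ d.val) • v)) := by
      intro v
      have := h4 (((-1 : ℂ) ^ d.val) • v)
      rw [map_smul (ι _), mul_smul_comm, smul_mul_assoc, smul_smul, hs, one_smul] at this
      exact this.symm
    ext x
    constructor
    · rintro ⟨_, ⟨v, rfl⟩, rfl⟩
      exact ⟨_, (key v).symm⟩
    · rintro ⟨v, rfl⟩
      refine ⟨_, ⟨((-1 : ℂ) ^ d.val) • f.symm v, rfl⟩, ?_⟩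
      simp only []
      rw [key, smul_smul, hs, one_smul, f.apply_symm_apply]
  · intro v
    rw [hinv]
    exact h4 v
end
end

section
/- Let n ∈ ℕ, let ε ∈ {1, −1}, and let S be the complex vector space with basis {x_I : I ⊆ {1,…,n}}. For i ∈ {1,…,n} define linear operators on S by: ψ_i x_I = (−1)^{|{j ∈ I : j < i}|} x_{I∖{i}} if i ∈ I and 0 otherwise; ψ_{−i} x_I = (−1)^{|{j ∈ I : j < i}|} x_{I∪{i}} if i ∉ I and 0 otherwise; and ψ_0 x_I = (ε/√2)(−1)^{|I|} x_I. Then for every permutation ϖ of the set {−n, −n+1, …, n−1, n}, the composite operator ψ_{ϖ(−n)} ∘ ψ_{ϖ(−n+1)} ∘ ⋯ ∘ ψ_{ϖ(n)} (so that ψ_{ϖ(n)} is applied first) sends x_I to (ε/√2)·sgn(ϖ)·x_I if I = I_ϖ, and to 0 otherwise, where I_ϖ := { i ∈ {1,…,n} : ϖ⁻¹(−i) < ϖ⁻¹(i) } and sgn(ϖ) denotes the sign of the permutation ϖ. -/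
noncomputable section

/-- The basis vector `x_I` of the complex vector space `S` with basis indexed by the
subsets `I ⊆ {1,…,n}`, realized inside the function space `Finset (Fin n) → ℂ`. -/
def xB (n : ℕ) (I : Finset (Fin n)) : Finset (Fin n) → ℂ := Pi.single I 1

lemma self_neg_zero {n : ℕ} (X : Module.End ℂ (Finset (Fin n) → ℂ)) (h : X = -X) : X = 0 := by
  have h2 : (2 : ℂ) • X = 0 := by
    rw [two_smul]; exact add_eq_zero_iff_eq_neg.mpr h
  exact (smul_eq_zero.mp h2).resolve_left two_ne_zero

lemma xB_ext {n : ℕ} {S T : Module.End ℂ (Finset (Fin n) → ℂ)}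
    (h : ∀ I, S (xB n I) = T (xB n I)) : S = T := by
  apply (Pi.basisFun ℂ (Finset (Fin n))).ext
  intro I
  simpa [xB, Pi.basisFun_apply] using h I

def sg {n : ℕ} (I : Finset (Fin n)) (i : Fin n) : ℂ :=
  (-1 : ℂ) ^ (I.filter (fun j => j < i)).card

lemma sg_sq {n : ℕ} (I : Finset (Fin n)) (i : Fin n) : sg I i * sg I i = 1 := by
  unfold sg; rw [← mul_pow]; simp

lemma sg_insert {n : ℕ} (I : Finset (Fin n)) (i j : Fin n) (h : j ∉ I) :
    sg (insert j I) i = if j < i then - sg I i else sg I i := by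
  unfold sg
  rw [Finset.filter_insert]
  split_ifs with hh
  · rw [Finset.card_insert_of_notMem (by simp [h]), pow_succ]; ring
  · rfl

lemma sg_erase {n : ℕ} (I : Finset (Fin n)) (i j : Fin n) (h : j ∈ I) :
    sg (I.erase j) i = if j < i then - sg I i else sg I i := by
  have := sg_insert (I.erase j) i j (by simp)
  rw [Finset.insert_erase h] at this
  rw [this]; split_ifs <;> simp

lemma pw_insert {n : ℕ} (I : Finset (Fin n)) (j : Fin n) (h : j ∉ I) :
    (-1 : ℂ) ^ (insert j I).card = - (-1 : ℂ) ^ I.card := by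
  rw [Finset.card_insert_of_notMem h, pow_succ]; ring

lemma pw_erase {n : ℕ} (I : Finset (Fin n)) (j : Fin n) (h : j ∈ I) :
    (-1 : ℂ) ^ (I.erase j).card = - (-1 : ℂ) ^ I.card := by
  have := pw_insert (I.erase j) j (by simp)
  rw [Finset.insert_erase h] at this
  rw [this]; simp

structure CAR {R : Type*} [Ring R] (n : ℕ) (Ψ : ℤ → R) : Prop where
  anti : ∀ (a b : ℤ) (_ : |a| ≤ n) (_ : |b| ≤ n) (_ : a ≠ b) (_ : a ≠ -b),
    Ψ a * Ψ b = - (Ψ b * Ψ a)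
  sq : ∀ (a : ℤ) (_ : |a| ≤ n) (_ : a ≠ 0), Ψ a * Ψ a = 0
  pair : ∀ (a : ℤ) (_ : |a| ≤ n) (_ : a ≠ 0), Ψ a * Ψ (-a) + Ψ (-a) * Ψ a = 1

section
variable {R : Type*} [Ring R] {n : ℕ} {Ψ : ℤ → R}

lemma CAR.list (h : CAR n Ψ) (a : ℤ) (ha : |a| ≤ n) (L : List ℤ)
    (hL : ∀ b ∈ L, |b| ≤ n ∧ b ≠ a ∧ b ≠ -a) :
    (L.map Ψ).prod * (Ψ a + Ψ (-a)) = (-1) ^ L.length * ((Ψ a + Ψ (-a)) * (L.map Ψ).prod) := by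
  induction L with
  | nil => simp
  | cons b L ih =>
    obtain ⟨h1, h2, h3⟩ := hL b (by simp)
    have e : Ψ b * (Ψ a + Ψ (-a)) = - ((Ψ a + Ψ (-a)) * Ψ b) := by
      rw [mul_add, add_mul, h.anti b a h1 ha h2 h3,
        h.anti b (-a) h1 (by simpa using ha) h3 (by simpa using h2)]
      abel
    have ih := ih (fun b hb => hL b (by simp [hb]))
    have cm : Ψ b * (-1) ^ L.length = (-1) ^ L.length * Ψ b :=
      ((Commute.neg_one_right (Ψ b)).pow_right _)
    simp only [List.map_cons, List.prod_cons, List.length_cons]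
    rw [mul_assoc, ih, ← mul_assoc, cm, mul_assoc, ← mul_assoc (Ψ b), e, pow_succ]
    simp only [neg_mul, mul_neg, one_mul, mul_assoc]

lemma CAR.swp (h : CAR n Ψ) (a b : ℤ) (ha : |a| ≤ n) (hb : |b| ≤ n) (h1 : a ≠ b) (h2 : a ≠ -b)
    (A B : List ℤ) :
    ((A ++ a :: b :: B).map Ψ).prod = - ((A ++ b :: a :: B).map Ψ).prod := by
  simp only [List.map_append, List.map_cons, List.prod_append, List.prod_cons]
  rw [← mul_assoc (Ψ _) (Ψ _), h.anti a b ha hb h1 h2]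
  simp only [neg_mul, mul_neg, mul_assoc]

lemma CAR.conj (h : CAR n Ψ) (a : ℤ) (ha : |a| ≤ n) (h0 : a ≠ 0) (A B : List ℤ)
    (hA : ∀ b ∈ A, |b| ≤ n ∧ b ≠ a ∧ b ≠ -a) (hB : ∀ b ∈ B, |b| ≤ n ∧ b ≠ a ∧ b ≠ -a)
    (hl : Odd (A.length + B.length)) :
    ((A ++ (-a) :: a :: B).map Ψ).prod
      = - ((Ψ a + Ψ (-a)) * (((A ++ a :: (-a) :: B).map Ψ).prod * (Ψ a + Ψ (-a)))) := by
  have ha' : |(-a)| ≤ n := by simpa using ha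
  have hB' := h.list a ha B hB
  have hA' := h.list a ha A hA
  have s1 := h.sq a ha h0
  have s2 := h.sq (-a) ha' (by simpa using h0)
  have p := h.pair a ha h0
  simp only [List.map_append, List.map_cons, List.prod_append, List.prod_cons]
  set X := (A.map Ψ).prod
  set Y := (B.map Ψ).prod
  set G := Ψ a + Ψ (-a) with hG
  have g2 : G * G = 1 := by
    rw [hG, mul_add, add_mul, add_mul, s1, s2, zero_add, add_zero, add_comm, p]
  have g3 : Ψ a * (Ψ (-a) * G) = G * (Ψ (-a) * Ψ a) := by
    rw [hG, mul_add, s2, add_zero, add_mul, ← mul_assoc (Ψ (-a)) (Ψ (-a)), s2, zero_mul, add_zero]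
  have e1 : X * (Ψ a * (Ψ (-a) * Y)) * G
      = (-1) ^ (A.length + B.length) * (G * (X * (Ψ (-a) * (Ψ a * Y)))) := by
    calc X * (Ψ a * (Ψ (-a) * Y)) * G = X * (Ψ a * (Ψ (-a) * (Y * G))) := by
          simp only [mul_assoc]
      _ = X * (Ψ a * (Ψ (-a) * ((-1) ^ B.length * (G * Y)))) := by rw [hB']
      _ = X * ((-1) ^ B.length * (Ψ a * (Ψ (-a) * G)) * Y) := by
          rcases neg_one_pow_eq_or R B.length with h | h <;> rw [h] <;> simp [mul_assoc]
      _ = ((-1) ^ B.length * (X * G)) * (Ψ (-a) * Ψ a * Y) := by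
          rw [g3]
          rcases neg_one_pow_eq_or R B.length with h | h <;> rw [h] <;> simp [mul_assoc]
      _ = _ := by
          rw [hA', pow_add]
          rcases neg_one_pow_eq_or R B.length with h | h <;> rw [h] <;> simp [mul_assoc]
  rw [e1, hl.neg_one_pow]
  simp only [neg_mul, one_mul, mul_neg, neg_neg]
  rw [← mul_assoc G G, g2, one_mul]

end

structure FRel (n : ℕ) (c : ℂ) (Ψ : ℤ → Module.End ℂ (Finset (Fin n) → ℂ)) : Prop where
  pos : ∀ (i : Fin n) (I : Finset (Fin n)),
      Ψ (((i : ℕ) : ℤ) + 1) (xB n I) = if i ∈ I then sg I i • xB n (I.erase i) else 0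
  neg : ∀ (i : Fin n) (I : Finset (Fin n)),
      Ψ (-(((i : ℕ) : ℤ) + 1)) (xB n I) = if i ∈ I then 0 else sg I i • xB n (insert i I)
  zero : ∀ I : Finset (Fin n), Ψ 0 (xB n I) = (c * (-1 : ℂ) ^ I.card) • xB n I

section
variable {n : ℕ} {c : ℂ} {Ψ : ℤ → Module.End ℂ (Finset (Fin n) → ℂ)}

lemma FRel.pp (h : FRel n c Ψ) (i j : Fin n) :
    Ψ (((i : ℕ) : ℤ) + 1) * Ψ (((j : ℕ) : ℤ) + 1)
      = - (Ψ (((j : ℕ) : ℤ) + 1) * Ψ (((i : ℕ) : ℤ) + 1)) := by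
  apply xB_ext; intro I
  rw [LinearMap.neg_apply, Module.End.mul_apply, Module.End.mul_apply, h.pos, h.pos]
  rcases eq_or_ne i j with rfl | hij
  · split_ifs with hi <;> simp [h.pos]
  by_cases hi : i ∈ I <;> by_cases hj : j ∈ I <;> simp [h.pos, hi, hj, hij, hij.symm]
  rw [sg_erase _ _ _ hi, sg_erase _ _ _ hj, Finset.erase_right_comm]
  rcases lt_or_gt_of_ne hij with h1 | h1 <;>
    simp [h1, h1.not_gt, smul_smul, mul_comm]

lemma FRel.nn (h : FRel n c Ψ) (i j : Fin n) :
    Ψ (-(((i : ℕ) : ℤ) + 1)) * Ψ (-(((j : ℕ) : ℤ) + 1))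
      = - (Ψ (-(((j : ℕ) : ℤ) + 1)) * Ψ (-(((i : ℕ) : ℤ) + 1))) := by
  apply xB_ext; intro I
  rw [LinearMap.neg_apply, Module.End.mul_apply, Module.End.mul_apply, h.neg, h.neg]
  rcases eq_or_ne i j with rfl | hij
  · split_ifs with hi <;> simp [h.neg, -neg_add_rev]
  by_cases hi : i ∈ I <;> by_cases hj : j ∈ I <;>
    simp [h.neg, hi, hj, hij, hij.symm, -neg_add_rev]
  rw [sg_insert _ _ _ hi, sg_insert _ _ _ hj, Finset.insert_comm]
  rcases lt_or_gt_of_ne hij with h1 | h1 <;>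
    simp [h1, h1.not_gt, smul_smul, mul_comm]

lemma FRel.pn (h : FRel n c Ψ) (i j : Fin n) (hij : i ≠ j) :
    Ψ (((i : ℕ) : ℤ) + 1) * Ψ (-(((j : ℕ) : ℤ) + 1))
      = - (Ψ (-(((j : ℕ) : ℤ) + 1)) * Ψ (((i : ℕ) : ℤ) + 1)) := by
  apply xB_ext; intro I
  rw [LinearMap.neg_apply, Module.End.mul_apply, Module.End.mul_apply, h.pos, h.neg]
  by_cases hi : i ∈ I <;> by_cases hj : j ∈ I <;>
    simp [h.neg, h.pos, hi, hj, hij, hij.symm, -neg_add_rev]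
  rw [sg_erase _ _ _ hi, sg_insert _ _ _ hj, Finset.erase_insert_of_ne hij.symm]
  rcases lt_or_gt_of_ne hij with h1 | h1 <;>
    simp [h1, h1.not_gt, smul_smul, mul_comm]

lemma FRel.pz (h : FRel n c Ψ) (i : Fin n) :
    Ψ (((i : ℕ) : ℤ) + 1) * Ψ 0 = - (Ψ 0 * Ψ (((i : ℕ) : ℤ) + 1)) := by
  apply xB_ext; intro I
  rw [LinearMap.neg_apply, Module.End.mul_apply, Module.End.mul_apply, h.pos, h.zero]
  by_cases hi : i ∈ I <;> simp [h.pos, h.zero, hi, -Finset.card_erase_of_mem]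
  rw [pw_erase _ _ hi]
  simp [smul_smul, mul_comm]

lemma FRel.nz (h : FRel n c Ψ) (i : Fin n) :
    Ψ (-(((i : ℕ) : ℤ) + 1)) * Ψ 0 = - (Ψ 0 * Ψ (-(((i : ℕ) : ℤ) + 1))) := by
  apply xB_ext; intro I
  rw [LinearMap.neg_apply, Module.End.mul_apply, Module.End.mul_apply, h.neg, h.zero]
  by_cases hi : i ∈ I <;> simp [h.neg, h.zero, hi, -neg_add_rev, -Finset.card_insert_of_notMem]
  rw [pw_insert _ _ hi]
  simp [smul_smul, mul_comm]

lemma FRel.pair' (h : FRel n c Ψ) (i : Fin n) :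
    Ψ (((i : ℕ) : ℤ) + 1) * Ψ (-(((i : ℕ) : ℤ) + 1))
      + Ψ (-(((i : ℕ) : ℤ) + 1)) * Ψ (((i : ℕ) : ℤ) + 1) = 1 := by
  apply xB_ext; intro I
  rw [LinearMap.add_apply, Module.End.mul_apply, Module.End.mul_apply, h.pos, h.neg]
  by_cases hi : i ∈ I <;>
    simp [h.neg, h.pos, hi, -neg_add_rev]
  · rw [sg_erase _ _ _ hi]; simp [smul_smul, sg_sq]
  · rw [sg_insert _ _ _ hi]; simp [smul_smul, sg_sq]

lemma cases_int (a : ℤ) (ha : |a| ≤ n) :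
    a = 0 ∨ (∃ i : Fin n, a = ((i : ℕ) : ℤ) + 1) ∨ (∃ i : Fin n, a = -(((i : ℕ) : ℤ) + 1)) := by
  rw [abs_le] at ha
  rcases lt_trichotomy a 0 with h | h | h
  · right; right; exact ⟨⟨(-a-1).toNat, by omega⟩, by simp; omega⟩
  · exact Or.inl h
  · right; left; exact ⟨⟨(a-1).toNat, by omega⟩, by simp; omega⟩

lemma FRel.anti (h : FRel n c Ψ) (a b : ℤ) (ha : |a| ≤ n) (hb : |b| ≤ n) (h1 : a ≠ b)
    (h2 : a ≠ -b) : Ψ a * Ψ b = - (Ψ b * Ψ a) := by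
  rcases cases_int a ha with rfl | ⟨i, rfl⟩ | ⟨i, rfl⟩ <;>
  rcases cases_int b hb with rfl | ⟨j, rfl⟩ | ⟨j, rfl⟩
  · exact absurd rfl h1
  · rw [h.pz, neg_neg]
  · rw [h.nz, neg_neg]
  · exact h.pz i
  · exact h.pp i j
  · exact h.pn i j (by rintro rfl; simp at h1 h2)
  · exact h.nz i
  · rw [h.pn j i (by rintro rfl; simp at h1 h2), neg_neg]
  · exact h.nn i j

lemma FRel.sq (h : FRel n c Ψ) (a : ℤ) (ha : |a| ≤ n) (h0 : a ≠ 0) : Ψ a * Ψ a = 0 := by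
  rcases cases_int a ha with rfl | ⟨i, rfl⟩ | ⟨i, rfl⟩
  · exact absurd rfl h0
  · exact self_neg_zero _ (h.pp i i)
  · exact self_neg_zero _ (h.nn i i)

lemma FRel.pair (h : FRel n c Ψ) (a : ℤ) (ha : |a| ≤ n) (h0 : a ≠ 0) :
    Ψ a * Ψ (-a) + Ψ (-a) * Ψ a = 1 := by
  rcases cases_int a ha with rfl | ⟨i, rfl⟩ | ⟨i, rfl⟩
  · exact absurd rfl h0
  · exact h.pair' i
  · rw [add_comm, neg_neg]; exact h.pair' i

lemma FRel.gam_apply (h : FRel n c Ψ) (i : Fin n) (I : Finset (Fin n)) :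
    (Ψ (((i : ℕ) : ℤ) + 1) + Ψ (-(((i : ℕ) : ℤ) + 1))) (xB n I)
      = sg I i • xB n (symmDiff I {i}) := by
  rw [LinearMap.add_apply, h.pos, h.neg]
  have : symmDiff I {i} = if i ∈ I then I.erase i else insert i I := by
    ext x
    by_cases hi : i ∈ I <;> simp [hi, Finset.mem_symmDiff] <;> grind
  rw [this]
  split_ifs <;> simp

lemma FRel.car (h : FRel n c Ψ) : CAR n Ψ := ⟨h.anti, h.sq, h.pair⟩

end

lemma ofFn_swap {α : Type*} (m : ℕ) (f : Fin (m + 1) → α) (p : Fin m) :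
    ∃ A B : List α, List.ofFn f = A ++ f p.castSucc :: f p.succ :: B ∧
      List.ofFn (f ∘ Equiv.swap p.castSucc p.succ) = A ++ f p.succ :: f p.castSucc :: B := by
  induction m with
  | zero => exact p.elim0
  | succ m ih =>
    refine Fin.cases ?_ (fun q => ?_) p
    · refine ⟨[], List.ofFn (fun i : Fin m => f i.succ.succ), ?_, ?_⟩
      · simp [List.ofFn_succ]
      · simp only [List.ofFn_succ, List.nil_append, Function.comp]
        congr 1
    · obtain ⟨A, B, h1, h2⟩ := ih (fun i => f i.succ) q
      refine ⟨f 0 :: A, B, ?_, ?_⟩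
      · rw [List.ofFn_succ, h1]; simp
      · rw [List.ofFn_succ]
        have e0 : (f ∘ Equiv.swap q.succ.castSucc q.succ.succ) 0 = f 0 := by
          simp only [Function.comp]; congr 1
        have e1 : (fun i : Fin (m+1) => (f ∘ Equiv.swap q.succ.castSucc q.succ.succ) i.succ)
            = (fun i => f i.succ) ∘ Equiv.swap q.castSucc q.succ := by
          funext i
          simp only [Function.comp]; congr 1
          simp only [Equiv.swap_apply_def, Fin.ext_iff]
          split_ifs <;> simp_all
        rw [e0, e1, h2]; simp

lemma swap_lt (m : ℕ) (p : Fin m) (x y : Fin (m + 1)) (hxy : x ≠ y)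
    (h1 : ¬ (x = p.castSucc ∧ y = p.succ)) (h2 : ¬ (y = p.castSucc ∧ x = p.succ)) :
    (Equiv.swap p.castSucc p.succ x < Equiv.swap p.castSucc p.succ y ↔ x < y) := by
  simp only [Equiv.swap_apply_def, Fin.ext_iff, Fin.lt_def] at *
  split_ifs <;> simp_all <;> omega

lemma FRel.base {n : ℕ} {c : ℂ} {Ψ : ℤ → Module.End ℂ (Finset (Fin n) → ℂ)} (h : FRel n c Ψ)
    (k : ℕ) (hk : k ≤ n) (I : Finset (Fin n)) :
    ((List.ofFn fun p : Fin (2 * k + 1) => Ψ (((p : ℕ) : ℤ) - (k : ℤ))).prod) (xB n I) =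
      if ∀ i : Fin n, (i : ℕ) < k → i ∈ I then (c * (-1 : ℂ) ^ (I.card + k)) • xB n I else 0 := by
  induction k generalizing I with
  | zero => simp [h.zero]
  | succ k ih =>
    have e : (List.ofFn fun p : Fin (2 * (k + 1) + 1) => Ψ (((p : ℕ) : ℤ) - ((k + 1 : ℕ) : ℤ))).prod
        = Ψ (-((k : ℤ) + 1)) * ((List.ofFn fun p : Fin (2 * k + 1) =>
          Ψ (((p : ℕ) : ℤ) - (k : ℤ))).prod * Ψ ((k : ℤ) + 1)) := by
      have : (List.ofFn fun p : Fin (2 * (k + 1) + 1) => Ψ (((p : ℕ) : ℤ) - ((k + 1 : ℕ) : ℤ)))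
         = (List.ofFn fun p : Fin ((2 * k + 1) + 1 + 1) =>
            Ψ (((p : ℕ) : ℤ) - ((k + 1 : ℕ) : ℤ))) := rfl
      rw [this, List.ofFn_succ, List.ofFn_succ_last]
      simp only [List.prod_cons, List.prod_append, List.prod_nil, mul_one]
      congr 1
      congr 1
      · congr 1; simp
      · congr 1; simp; ring
    let i : Fin n := ⟨k, hk⟩
    have hp := h.pos i I
    have hi' : ((i : ℕ) : ℤ) = k := rfl
    rw [hi'] at hp
    rw [e, Module.End.mul_apply, Module.End.mul_apply, hp]
    by_cases hi : i ∈ I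
    · rw [if_pos hi, map_smul, ih (by omega)]
      have hc : (∀ j : Fin n, (j : ℕ) < k → j ∈ I.erase i) ↔
          (∀ j : Fin n, (j : ℕ) < k + 1 → j ∈ I) := by
        constructor
        · intro H j hj
          by_cases hji : j = i
          · rwa [hji]
          · exact Finset.mem_of_mem_erase (H j (by
              have : (j : ℕ) ≠ k := fun hh => hji (Fin.ext hh)
              omega))
        · intro H j hj
          refine Finset.mem_erase.mpr ⟨?_, H j (by omega)⟩
          rintro rfl
          exact absurd hj (lt_irrefl k)
      simp only [hc]
      split_ifs with H
      · have hn := h.neg i (I.erase i)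
        rw [hi'] at hn
        rw [map_smul, map_smul, hn, if_neg (by simp), Finset.insert_erase hi, sg_erase _ _ _ hi,
          if_neg (lt_irrefl _), smul_smul, smul_smul]
        congr 1
        have := sg_sq I i
        rw [pow_add, pow_add, pw_erase _ _ hi, pow_succ]
        linear_combination (- c * (-1) ^ I.card * (-1) ^ k) * this
      · simp
    · rw [if_neg hi, if_neg (fun H => hi (H i (by simp [i])))]
      simp

def vv {n : ℕ} (v : Fin (2 * n + 1)) : ℤ := ((v : ℕ) : ℤ) - n

lemma vv_le {n : ℕ} (v : Fin (2 * n + 1)) : |vv v| ≤ n := by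
  have := v.isLt
  unfold vv; rw [abs_le]; omega

lemma vv_inj {n : ℕ} {v w : Fin (2 * n + 1)} (h : vv v = vv w) : v = w := by
  unfold vv at h; apply Fin.ext; omega

lemma nI_lt {n : ℕ} (i : Fin n) : n - ((i : ℕ) + 1) < 2 * n + 1 := by omega
lemma pI_lt {n : ℕ} (i : Fin n) : n + (i : ℕ) + 1 < 2 * n + 1 := by
  have := i.isLt; omega
def nI {n : ℕ} (i : Fin n) : Fin (2 * n + 1) := ⟨n - ((i : ℕ) + 1), nI_lt i⟩
def pI {n : ℕ} (i : Fin n) : Fin (2 * n + 1) := ⟨n + (i : ℕ) + 1, pI_lt i⟩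

lemma vv_nI {n : ℕ} (i : Fin n) : vv (nI i) = -(((i : ℕ) : ℤ) + 1) := by
  have := i.isLt
  simp only [vv, nI]; omega
lemma vv_pI {n : ℕ} (i : Fin n) : vv (pI i) = (((i : ℕ) : ℤ) + 1) := by
  simp only [vv, pI]; push_cast; ring

def IS {n : ℕ} (ϖ : Equiv.Perm (Fin (2 * n + 1))) : Finset (Fin n) :=
  Finset.univ.filter (fun i : Fin n => ϖ⁻¹ (nI i) < ϖ⁻¹ (pI i))

lemma nI_ne_pI {n : ℕ} (i j : Fin n) : nI i ≠ pI j := by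
  intro h
  have := congrArg vv h
  rw [vv_nI, vv_pI] at this; omega

lemma pI_inj {n : ℕ} {i j : Fin n} (h : pI i = pI j) : i = j := by
  have := congrArg vv h
  rw [vv_pI, vv_pI] at this; apply Fin.ext; omega
lemma nI_inj {n : ℕ} {i j : Fin n} (h : nI i = nI j) : i = j := by
  have := congrArg vv h
  rw [vv_nI, vv_nI] at this; apply Fin.ext; omega

/-- membership is unchanged unless the swapped values are exactly `±i` -/
lemma IS_swap_of_ne {n : ℕ} (ϖ : Equiv.Perm (Fin (2 * n + 1))) (p : Fin (2 * n)) (i : Fin n)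
    (h1 : ¬ (ϖ p.castSucc = nI i ∧ ϖ p.succ = pI i))
    (h2 : ¬ (ϖ p.castSucc = pI i ∧ ϖ p.succ = nI i)) :
    i ∈ IS (ϖ * Equiv.swap p.castSucc p.succ) ↔ i ∈ IS ϖ := by
  simp only [IS, Finset.mem_filter, Finset.mem_univ, true_and, mul_inv_rev, Equiv.swap_inv,
    Equiv.Perm.mul_apply]
  apply swap_lt
  · intro h; exact nI_ne_pI i i (ϖ⁻¹.injective h)
  · rintro ⟨a, b⟩; exact h1 ⟨by rw [← a]; simp, by rw [← b]; simp⟩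
  · rintro ⟨a, b⟩; exact h2 ⟨by rw [← a]; simp, by rw [← b]; simp⟩

lemma IS_swap_of_eq {n : ℕ} (ϖ : Equiv.Perm (Fin (2 * n + 1))) (p : Fin (2 * n)) (i : Fin n)
    (h : (ϖ p.castSucc = nI i ∧ ϖ p.succ = pI i) ∨ (ϖ p.castSucc = pI i ∧ ϖ p.succ = nI i)) :
    i ∈ IS (ϖ * Equiv.swap p.castSucc p.succ) ↔ i ∉ IS ϖ := by
  simp only [IS, Finset.mem_filter, Finset.mem_univ, true_and, mul_inv_rev, Equiv.swap_inv,
    Equiv.Perm.mul_apply]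
  rcases h with ⟨a, b⟩ | ⟨a, b⟩ <;> rw [← a, ← b] <;>
    simp [Fin.lt_def]

lemma IS_symm {n : ℕ} (ϖ : Equiv.Perm (Fin (2 * n + 1))) (p : Fin (2 * n)) (i : Fin n)
    (h : (ϖ p.castSucc = nI i ∧ ϖ p.succ = pI i) ∨ (ϖ p.castSucc = pI i ∧ ϖ p.succ = nI i)) :
    IS (ϖ * Equiv.swap p.castSucc p.succ) = symmDiff (IS ϖ) {i} := by
  ext j
  rw [Finset.mem_symmDiff, Finset.mem_singleton]
  by_cases hj : j = i
  · subst hj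
    rw [IS_swap_of_eq ϖ p j h]; simp
  · rw [IS_swap_of_ne]
    · simp [hj]
    · rintro ⟨a, b⟩
      rcases h with ⟨a', b'⟩ | ⟨a', b'⟩
      · exact hj (nI_inj (a.symm.trans a'))
      · exact nI_ne_pI _ _ (a.symm.trans a')
    · rintro ⟨a, b⟩
      rcases h with ⟨a', b'⟩ | ⟨a', b'⟩
      · exact nI_ne_pI _ _ (a'.symm.trans a)
      · exact hj (pI_inj (a.symm.trans a'))

lemma FRel.step {n : ℕ} {c : ℂ} {Ψ : ℤ → Module.End ℂ (Finset (Fin n) → ℂ)} (h : FRel n c Ψ)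
    (ϖ : Equiv.Perm (Fin (2 * n + 1))) (p : Fin (2 * n))
    (ih : ∀ I, (((List.ofFn fun p => vv (ϖ p)).map Ψ).prod) (xB n I) =
      if I = IS ϖ then (c * ((Equiv.Perm.sign ϖ : ℤ) : ℂ)) • xB n I else 0)
    (I : Finset (Fin n)) :
    (((List.ofFn fun q => vv ((ϖ * Equiv.swap p.castSucc p.succ) q)).map Ψ).prod) (xB n I) =
      if I = IS (ϖ * Equiv.swap p.castSucc p.succ) then
        (c * ((Equiv.Perm.sign (ϖ * Equiv.swap p.castSucc p.succ) : ℤ) : ℂ)) • xB n I else 0 := by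
  have hne : p.castSucc ≠ p.succ := by simp [Fin.ext_iff]
  have hs : ((Equiv.Perm.sign (ϖ * Equiv.swap p.castSucc p.succ) : ℤ) : ℂ)
      = - ((Equiv.Perm.sign ϖ : ℤ) : ℂ) := by
    rw [Equiv.Perm.sign_mul, Equiv.Perm.sign_swap hne]; simp
  rw [hs]
  obtain ⟨A, B, hA, hB⟩ := ofFn_swap (2 * n) (fun q => vv (ϖ q)) p
  have hB' : (List.ofFn fun q => vv ((ϖ * Equiv.swap p.castSucc p.succ) q))
    = A ++ vv (ϖ p.succ) :: vv (ϖ p.castSucc) :: B := hB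
  rw [hB']
  rw [hA] at ih
  have hvne : vv (ϖ p.castSucc) ≠ vv (ϖ p.succ) := fun hh => hne (ϖ.injective (vv_inj hh))
  by_cases hop : vv (ϖ p.succ) = - vv (ϖ p.castSucc)
  · have hnd : (A ++ vv (ϖ p.castSucc) :: vv (ϖ p.succ) :: B).Nodup := by
      rw [← hA, List.nodup_ofFn]
      intro x y hxy; exact ϖ.injective (vv_inj hxy)
    have hlen := congrArg List.length hA
    have hbd : ∀ b ∈ A ++ vv (ϖ p.castSucc) :: vv (ϖ p.succ) :: B, |b| ≤ n := by
      rw [← hA]; intro b hb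
      obtain ⟨q, rfl⟩ := (List.mem_ofFn' _ _).mp hb
      exact vv_le _
    have h0 : vv (ϖ p.castSucc) ≠ 0 := by
      intro hh; apply hvne; rw [hop, hh]; simp
    obtain ⟨i, hi⟩ : ∃ i : Fin n, (ϖ p.castSucc = nI i ∧ ϖ p.succ = pI i) ∨
        (ϖ p.castSucc = pI i ∧ ϖ p.succ = nI i) := by
      rcases cases_int _ (vv_le (ϖ p.castSucc)) with hh | ⟨i, hh⟩ | ⟨i, hh⟩
      · exact absurd hh h0
      · refine ⟨i, Or.inr ⟨vv_inj (by rw [hh, vv_pI]), vv_inj (by rw [hop, hh, vv_nI])⟩⟩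
      · refine ⟨i, Or.inl ⟨vv_inj (by rw [hh, vv_nI]), vv_inj (by rw [hop, hh, vv_pI]; ring)⟩⟩
    have hG : Ψ (vv (ϖ p.castSucc)) + Ψ (-vv (ϖ p.castSucc)) =
        Ψ (((i : ℕ) : ℤ) + 1) + Ψ (-(((i : ℕ) : ℤ) + 1)) := by
      rcases hi with ⟨a, b⟩ | ⟨a, b⟩
      · rw [a, vv_nI, neg_neg, add_comm]
      · rw [a, vv_pI]
    have hle := vv_le (ϖ p.castSucc)
    rw [IS_symm ϖ p i hi]
    rw [hop] at hnd hbd ih ⊢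
    generalize vv (ϖ p.castSucc) = a at *
    have g2 : (Ψ a + Ψ (-a)) * (Ψ a + Ψ (-a)) = 1 := by
      rw [mul_add, add_mul, add_mul, h.sq a hle h0,
        h.sq (-a) (by simpa using hle) (by simpa using h0), zero_add, add_zero, add_comm,
        h.pair a hle h0]
    rw [h.car.conj a hle h0 A B ?_ ?_ ?_]
    · have g3 : (Ψ a + Ψ (-a)) ((Ψ a + Ψ (-a)) (xB n I)) = xB n I := by
        rw [← Module.End.mul_apply, g2]; rfl
      have g4 : (Ψ a + Ψ (-a)) (xB n I) = sg I i • xB n (symmDiff I {i}) := by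
        rw [hG, h.gam_apply]
      rw [LinearMap.neg_apply, Module.End.mul_apply, Module.End.mul_apply, g4, map_smul, ih]
      have hiff : symmDiff I {i} = IS ϖ ↔ I = symmDiff (IS ϖ) {i} := by
        constructor
        · intro hh; rw [← hh, symmDiff_symmDiff_cancel_right]
        · intro hh; rw [hh, symmDiff_symmDiff_cancel_right]
      simp only [hiff]
      split_ifs with H
      · rw [smul_comm, ← g4, map_smul, g3]; simp
      · simp
    · intro b hb
      refine ⟨hbd b (by simp [hb]), ?_, ?_⟩ <;> rintro rfl <;> 
        simp [List.nodup_append, hb] at hnd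
      · exact hnd.2.2 _ hb |>.1 rfl
      · exact hnd.2.2 _ hb |>.2.1 rfl
    · intro b hb
      refine ⟨hbd b (by simp [hb]), ?_, ?_⟩ <;> rintro rfl <;> 
        simp [List.nodup_append, hb] at hnd
    · simp at hlen
      have : 0 < n := by have := p.isLt; omega
      exact ⟨n - 1, by omega⟩
  · have hIS : IS (ϖ * Equiv.swap p.castSucc p.succ) = IS ϖ := by
      ext i
      apply IS_swap_of_ne
      · rintro ⟨a, b⟩; apply hop; rw [a, b, vv_nI, vv_pI]; ring
      · rintro ⟨a, b⟩; apply hop; rw [a, b, vv_nI, vv_pI]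
    have hop' : (List.map Ψ (A ++ vv (ϖ p.succ) :: vv (ϖ p.castSucc) :: B)).prod
        = - (List.map Ψ (A ++ vv (ϖ p.castSucc) :: vv (ϖ p.succ) :: B)).prod := by
      exact h.car.swp _ _ (vv_le _) (vv_le _) hvne.symm hop A B
    rw [hIS, hop', LinearMap.neg_apply, ih]
    split_ifs <;> simp

lemma FRel.main {n : ℕ} {c : ℂ} {Ψ : ℤ → Module.End ℂ (Finset (Fin n) → ℂ)} (h : FRel n c Ψ)
    (ϖ : Equiv.Perm (Fin (2 * n + 1))) : ∀ I,
    (((List.ofFn fun p => vv (ϖ p)).map Ψ).prod) (xB n I) =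
      if I = IS ϖ then (c * ((Equiv.Perm.sign ϖ : ℤ) : ℂ)) • xB n I else 0 := by
  have hm : ϖ ∈ Submonoid.closure
      (Set.range fun i : Fin (2 * n) ↦ Equiv.swap i.castSucc i.succ) := by
    rw [Equiv.Perm.mclosure_swap_castSucc_succ]; trivial
  induction hm using Submonoid.closure_induction_right with
  | one =>
    intro I
    have hb := h.base n le_rfl I
    rw [List.map_ofFn]
    have e : (IS (1 : Equiv.Perm (Fin (2 * n + 1)))) = Finset.univ := by
      ext i; simp [IS, nI, pI, Fin.lt_def]; omega
    have e2 : (∀ i : Fin n, (i : ℕ) < n → i ∈ I) ↔ I = Finset.univ := by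
      simp [Finset.eq_univ_iff_forall]
    rw [e]
    simp only [e2] at hb
    refine Eq.trans hb ?_
    split_ifs with hI
    · subst hI; simp [← two_mul]
    · rfl
  | mul_right x hx y hy ih =>
    obtain ⟨p, rfl⟩ := hy
    exact h.step x p ih

/-- Lemma 2.3 of the paper (`signlemma`).  Let `Ψ m`, for `m ∈ {−n,…,n}`, be the operators
on the space `S` with basis `{x_I : I ⊆ {1,…,n}}` given by: `Ψ i` (for `1 ≤ i ≤ n`) is the
fermionic annihilation operator `ψ_i`, `Ψ (−i)` is the creation operator `ψ_{−i} = ψ_i†`,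
and `Ψ 0 = ψ_0` acts by `(ε/√2)(−1)^{|I|}`.  Then for every permutation `ϖ` of
`{−n,…,n}` (encoded as a permutation of `Fin (2n+1)` via `p ↔ p − n`), the ordered
composite `ψ_{ϖ(−n)} ∘ ⋯ ∘ ψ_{ϖ(n)}` sends `x_I` to `(ε/√2)·sgn(ϖ)·x_I` if `I = I_ϖ`
and to `0` otherwise, where `I_ϖ = {i : ϖ⁻¹(−i) < ϖ⁻¹(i)}`. -/
theorem statement9 (n : ℕ) (ε : ℂ) (hε : ε = 1 ∨ ε = -1)
    (Ψ : ℤ → Module.End ℂ (Finset (Fin n) → ℂ))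
    (hpos : ∀ (i : Fin n) (I : Finset (Fin n)),
      Ψ (((i : ℕ) : ℤ) + 1) (xB n I) =
        if i ∈ I then ((-1 : ℂ) ^ (I.filter (fun j => j < i)).card) • xB n (I.erase i)
        else 0)
    (hneg : ∀ (i : Fin n) (I : Finset (Fin n)),
      Ψ (-(((i : ℕ) : ℤ) + 1)) (xB n I) =
        if i ∈ I then 0
        else ((-1 : ℂ) ^ (I.filter (fun j => j < i)).card) • xB n (insert i I))
    (hzero : ∀ I : Finset (Fin n),
      Ψ 0 (xB n I) = ((ε / (Real.sqrt 2 : ℂ)) * (-1 : ℂ) ^ I.card) • xB n I)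
    (ϖ : Equiv.Perm (Fin (2 * n + 1))) (I : Finset (Fin n)) :
    ((List.ofFn fun p : Fin (2 * n + 1) => Ψ (((ϖ p : ℕ) : ℤ) - (n : ℤ))).prod) (xB n I) =
      if I = Finset.univ.filter (fun i : Fin n =>
            ϖ⁻¹ ⟨n - ((i : ℕ) + 1), by omega⟩ <
            ϖ⁻¹ ⟨n + (i : ℕ) + 1, by have := i.isLt; omega⟩)
      then ((ε / (Real.sqrt 2 : ℂ)) * ((Equiv.Perm.sign ϖ : ℤ) : ℂ)) • xB n I
      else 0 := by
  have h : FRel n (ε / (Real.sqrt 2 : ℂ)) Ψ := ⟨hpos, hneg, hzero⟩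
  have := h.main ϖ I
  rw [List.map_ofFn] at this
  exact this

end
end

section
/- Let n ∈ ℕ, let N ∈ {2n, 2n+1}, and let S be the complex vector space with basis {x_I : I ⊆ {1,…,n}}. Define a bilinear form Φ_S on S by Φ_S(x_I, x_J) = (−1)^{C(|I|,2) + nN|I| + |{(i,j) ∈ I × Iᶜ : i > j}|} if J = Iᶜ (the complement of I in {1,…,n}), and Φ_S(x_I, x_J) = 0 otherwise, where C(m,2) = m(m−1)/2. Then Φ_S(x, y) = (−1)^{C(n,2) + nN} Φ_S(y, x) for all x, y ∈ S. -/
noncomputable section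

/-- The value `Φ_S(x_I, x_J)` of the bilinear form `Φ_S` on basis vectors: it is
`(−1)^{C(|I|,2) + nN|I| + #{(i,j) ∈ I × Iᶜ : i > j}}` if `J = Iᶜ` and `0` otherwise. -/
def phiSCoeff (n N : ℕ) (I J : Finset (Fin n)) : ℂ :=
  if J = Iᶜ then
    (-1 : ℂ) ^ (Nat.choose I.card 2 + n * N * I.card +
      ((I ×ˢ Iᶜ).filter (fun p => p.2 < p.1)).card)
  else 0

/-- The bilinear form `Φ_S` on `S`, extended bilinearly from its values on basis vectors. -/
def PhiS (n N : ℕ) (f g : Finset (Fin n) → ℂ) : ℂ :=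
  ∑ I : Finset (Fin n), ∑ J : Finset (Fin n), f I * g J * phiSCoeff n N I J

theorem aux_choose (k m : ℕ) :
    Nat.choose (k + m) 2 = Nat.choose k 2 + Nat.choose m 2 + k * m := by
  induction m with
  | zero => simp
  | succ m ih =>
    have h1 : Nat.choose (k + (m + 1)) 2 = (k + m) + Nat.choose (k + m) 2 := by
      rw [← add_assoc, Nat.choose_succ_succ' (k + m) 1, Nat.choose_one_right]
    have h2 : Nat.choose (m + 1) 2 = m + Nat.choose m 2 := by
      rw [Nat.choose_succ_succ' m 1, Nat.choose_one_right]
    rw [h1, h2, ih]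
    ring

theorem aux_inv (n : ℕ) (I : Finset (Fin n)) :
    ((I ×ˢ Iᶜ).filter (fun p => p.2 < p.1)).card +
      ((Iᶜ ×ˢ I).filter (fun p => p.2 < p.1)).card = I.card * Iᶜ.card := by
  rw [← Finset.card_product,
    ← Finset.card_filter_add_card_filter_not (s := I ×ˢ Iᶜ) (fun p => p.2 < p.1)]
  congr 1
  apply Finset.card_bij (fun p _ => (p.2, p.1))
  · rintro ⟨a, b⟩ h
    simp only [Finset.mem_filter, Finset.mem_product, Finset.mem_compl] at h ⊢
    exact ⟨⟨h.1.2, h.1.1⟩, not_lt.mpr h.2.le⟩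
  · rintro ⟨a, b⟩ _ ⟨c, d⟩ _ h
    simp only [Prod.mk.injEq] at h ⊢
    exact ⟨h.2, h.1⟩
  · rintro ⟨a, b⟩ h
    simp only [Finset.mem_filter, Finset.mem_product, Finset.mem_compl] at h
    refine ⟨(b, a), ?_, rfl⟩
    simp only [Finset.mem_filter, Finset.mem_product, Finset.mem_compl]
    refine ⟨⟨h.1.2, h.1.1⟩, lt_of_le_of_ne (not_lt.mp h.2) ?_⟩
    rintro rfl
    exact h.1.2 h.1.1

theorem aux_coeff (n N : ℕ) (I J : Finset (Fin n)) :
    phiSCoeff n N I J = (-1 : ℂ) ^ (Nat.choose n 2 + n * N) * phiSCoeff n N J I := by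
  unfold phiSCoeff
  by_cases h : J = Iᶜ
  · subst h
    rw [if_pos rfl, if_pos (compl_compl I).symm, compl_compl, ← pow_add]
    have hi := aux_inv n I
    have hn : I.card + Iᶜ.card = n := by
      simpa using Finset.card_add_card_compl I
    have hc := aux_choose I.card Iᶜ.card
    rw [hn] at hc
    generalize ((I ×ˢ Iᶜ).filter (fun p => p.2 < p.1)).card = a at *
    generalize ((Iᶜ ×ˢ I).filter (fun p => p.2 < p.1)).card = b at *
    generalize Iᶜ.card = m at *
    generalize I.card = k at *
    obtain ⟨t, ht⟩ := Nat.even_mul_succ_self n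
    have hp : n * N + n * N * m + n * N * k = 2 * (t * N) := by
      have : n * N + n * N * m + n * N * k = n * (k + m + 1) * N := by ring
      rw [this, hn, ht]; ring
    rw [hc, ← hi]
    have e : (k.choose 2 + m.choose 2 + (a + b) + n * N + (m.choose 2 + n * N * m + b))
        + (k.choose 2 + n * N * k + a)
        = 2 * (k.choose 2 + m.choose 2 + a + b + t * N) := by
      linarith
    have hprod := congrArg (fun z => (-1 : ℂ) ^ z) e
    simp only [pow_mul, pow_add _ (_ + (m.choose 2 + n * N * m + b))] at hprod
    rw [neg_one_sq, one_pow] at hprod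
    have hs : ((-1 : ℂ) ^ (k.choose 2 + n * N * k + a)) *
        ((-1 : ℂ) ^ (k.choose 2 + n * N * k + a)) = 1 := by
      rw [← mul_pow]; simp
    generalize (-1 : ℂ) ^ (k.choose 2 + n * N * k + a) = u at *
    generalize (-1 : ℂ) ^ (k.choose 2 + m.choose 2 + (a + b) + n * N
      + (m.choose 2 + n * N * m + b)) = v at *
    linear_combination v * hs - u * hprod
  · have h' : ¬ I = Jᶜ := by
      rintro rfl
      exact h (compl_compl J).symm
    rw [if_neg h, if_neg h', mul_zero]

/-- Proposition: the bilinear form `Φ_S` satisfies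
`Φ_S(x, y) = (−1)^{C(n,2) + nN} Φ_S(y, x)` for all `x, y ∈ S`. -/
theorem statement10 (n N : ℕ) (hN : N = 2 * n ∨ N = 2 * n + 1)
    (x y : Finset (Fin n) → ℂ) :
    PhiS n N x y = (-1 : ℂ) ^ (Nat.choose n 2 + n * N) * PhiS n N y x := by
  unfold PhiS
  rw [Finset.sum_comm, Finset.mul_sum]
  refine Finset.sum_congr rfl fun J _ => ?_
  rw [Finset.mul_sum]
  refine Finset.sum_congr rfl fun I _ => ?_
  rw [aux_coeff n N I J]
  ring

end
end

section
/- Let n ∈ ℕ, let N ∈ {2n, 2n+1}, let ε ∈ {1,−1}, and let S be the complex vector space with basis {x_I : I ⊆ {1,…,n}}. Define the bilinear form Φ_S on S by Φ_S(x_I, x_J) = (−1)^{C(|I|,2) + nN|I| + |{(i,j) ∈ I × Iᶜ : i > j}|} if J = Iᶜ and 0 otherwise. Define operators on S by ψ_k† x_I = (−1)^{|{j ∈ I : j < k}|} x_{I∪{k}} if k ∉ I and 0 otherwise; ψ_k x_I = (−1)^{|{j ∈ I : j < k}|} x_{I∖{k}} if k ∈ I and 0 otherwise; and c x_I = ε(−1)^{|I|}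 x_I. Then for all 1 ≤ k ≤ n and all I, J ⊆ {1,…,n}: Φ_S(ψ_k† x_I, x_J) = (−1)^{nN} Φ_S(x_I, ψ_k† x_J) and Φ_S(ψ_k x_I, x_J) = (−1)^{nN} Φ_S(x_I, ψ_k x_J); moreover, if N = 2n+1 then Φ_S(c x_I, x_J) = (−1)^n Φ_S(x_I, c x_J). -/
noncomputable section

theorem aux_PhiS_xB (n N : ℕ) (a b : ℂ) (I J : Finset (Fin n)) :
    PhiS n N (a • xB n I) (b • xB n J) = a * b * phiSCoeff n N I J := by
  unfold PhiS xB
  rw [Finset.sum_eq_single I, Finset.sum_eq_single J]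
  · simp
  · intro K _ hK
    simp [Pi.single_apply, hK]
  · simp
  · intro K _ hK
    simp [Pi.single_apply, hK]
  · simp

theorem aux_PhiS_l (n N : ℕ) (a : ℂ) (I J : Finset (Fin n)) :
    PhiS n N (a • xB n I) (xB n J) = a * phiSCoeff n N I J := by
  simpa using aux_PhiS_xB n N a 1 I J

theorem aux_PhiS_r (n N : ℕ) (b : ℂ) (I J : Finset (Fin n)) :
    PhiS n N (xB n I) (b • xB n J) = b * phiSCoeff n N I J := by
  simpa using aux_PhiS_xB n N 1 b I J

theorem aux_zero_l (n N : ℕ) (g : Finset (Fin n) → ℂ) : PhiS n N 0 g = 0 := by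
  simp [PhiS]

theorem aux_zero_r (n N : ℕ) (g : Finset (Fin n) → ℂ) : PhiS n N g 0 = 0 := by
  simp [PhiS]

theorem aux_inv_l (n : ℕ) (k : Fin n) (A B : Finset (Fin n)) (hk : k ∉ A) :
    (((insert k A) ×ˢ B).filter (fun p => p.2 < p.1)).card =
      ((A ×ˢ B).filter (fun p => p.2 < p.1)).card + (B.filter (fun j => j < k)).card := by
  simp only [Finset.card_filter, Finset.sum_product]
  rw [Finset.sum_insert hk, add_comm]

theorem aux_inv_r (n : ℕ) (k : Fin n) (A B : Finset (Fin n)) (hk : k ∉ B) :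
    ((A ×ˢ (insert k B)).filter (fun p => p.2 < p.1)).card =
      ((A ×ˢ B).filter (fun p => p.2 < p.1)).card + (A.filter (fun j => k < j)).card := by
  simp only [Finset.card_filter, Finset.sum_product_right]
  rw [Finset.sum_insert hk, add_comm]

theorem aux_card (n : ℕ) (k : Fin n) (A : Finset (Fin n)) (hk : k ∉ A) :
    A.card = (A.filter (fun j => j < k)).card + (A.filter (fun j => k < j)).card := by
  rw [← Finset.card_filter_add_card_filter_not (s := A) (fun j => j < k)]
  congr 2
  apply Finset.filter_congr
  intro x hx
  have : x ≠ k := fun h => hk (h ▸ hx)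
  constructor
  · intro h
    exact lt_of_le_of_ne (not_lt.mp h) this.symm
  · intro h
    exact not_lt.mpr h.le

theorem aux_pow {a b : ℕ} (h : ∃ u v, a + 2 * u = b + 2 * v) : (-1 : ℂ) ^ a = (-1) ^ b := by
  obtain ⟨u, v, h⟩ := h
  have := congrArg (fun t => (-1 : ℂ) ^ t) h
  simpa [pow_add, pow_mul] using this

theorem aux_key (n N : ℕ) (k : Fin n) (A B : Finset (Fin n)) (hA : k ∉ A) (hB : k ∉ B)
    (h : Aᶜ = insert k B) :
    (-1 : ℂ) ^ (A.filter (fun j => j < k)).card * phiSCoeff n N (insert k A) B =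
      (-1) ^ (n * N) * ((-1) ^ (B.filter (fun j => j < k)).card *
        phiSCoeff n N A (insert k B)) := by
  have h2 : B = (insert k A)ᶜ := by
    rw [Finset.compl_insert, h, Finset.erase_insert hB]
  unfold phiSCoeff
  rw [if_pos h2, if_pos h.symm, ← h2, h, aux_inv_l n k A B hA, aux_inv_r n k A B hB,
    Finset.card_insert_of_notMem hA, Nat.choose_succ_succ' A.card 1, Nat.choose_one_right]
  have hc := aux_card n k A hA
  rw [← pow_add, ← pow_add, ← pow_add]
  apply aux_pow
  refine ⟨0, (A.filter (fun j => j < k)).card, ?_⟩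
  rw [mul_add]
  simp only [Nat.reduceAdd]
  omega

/-- Adjointness properties of the Clifford generators with respect to `Φ_S`:
`Φ_S(ψ_k† x_I, x_J) = (−1)^{nN} Φ_S(x_I, ψ_k† x_J)`,
`Φ_S(ψ_k x_I, x_J) = (−1)^{nN} Φ_S(x_I, ψ_k x_J)`, and, when `N = 2n+1`,
`Φ_S(c x_I, x_J) = (−1)^n Φ_S(x_I, c x_J)` where `c x_I = ε(−1)^{|I|} x_I`. -/
theorem statement11 (n N : ℕ) (hN : N = 2 * n ∨ N = 2 * n + 1)
    (ε : ℂ) (hε : ε = 1 ∨ ε = -1)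
    (ψ ψd : Fin n → Module.End ℂ (Finset (Fin n) → ℂ))
    (c : Module.End ℂ (Finset (Fin n) → ℂ))
    (hψd : ∀ (k : Fin n) (I : Finset (Fin n)),
      ψd k (xB n I) =
        if k ∈ I then 0
        else ((-1 : ℂ) ^ (I.filter (fun j => j < k)).card) • xB n (insert k I))
    (hψ : ∀ (k : Fin n) (I : Finset (Fin n)),
      ψ k (xB n I) =
        if k ∈ I then ((-1 : ℂ) ^ (I.filter (fun j => j < k)).card) • xB n (I.erase k)
        else 0)
    (hc : ∀ I : Finset (Fin n), c (xB n I) = (ε * (-1 : ℂ) ^ I.card) • xB n I)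
    (k : Fin n) (I J : Finset (Fin n)) :
    PhiS n N (ψd k (xB n I)) (xB n J) =
      (-1 : ℂ) ^ (n * N) * PhiS n N (xB n I) (ψd k (xB n J)) ∧
    PhiS n N (ψ k (xB n I)) (xB n J) =
      (-1 : ℂ) ^ (n * N) * PhiS n N (xB n I) (ψ k (xB n J)) ∧
    (N = 2 * n + 1 →
      PhiS n N (c (xB n I)) (xB n J) =
        (-1 : ℂ) ^ n * PhiS n N (xB n I) (c (xB n J))) := by
  refine ⟨?_, ?_, ?_⟩
  · rw [hψd, hψd]
    by_cases hI : k ∈ I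
    · rw [if_pos hI, aux_zero_l]
      split_ifs with hJ
      · rw [aux_zero_r, mul_zero]
      · rw [aux_PhiS_r, phiSCoeff, if_neg]
        · simp
        · intro h
          have : k ∈ Iᶜ := h ▸ Finset.mem_insert_self k J
          exact Finset.mem_compl.mp this hI
    · rw [if_neg hI, aux_PhiS_l]
      split_ifs with hJ
      · rw [aux_zero_r, phiSCoeff, if_neg]
        · simp
        · rintro rfl
          simp at hJ
      · rw [aux_PhiS_r]
        by_cases h : Iᶜ = insert k J
        · exact aux_key n N k I J hI hJ h
        · rw [phiSCoeff, phiSCoeff, if_neg, if_neg]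
          · simp
          · exact fun h' => h h'.symm
          · rintro rfl
            apply h
            rw [Finset.compl_insert, Finset.insert_erase (Finset.mem_compl.mpr hI)]
  · rw [hψ, hψ]
    by_cases hI : k ∈ I
    · rw [if_pos hI, aux_PhiS_l]
      split_ifs with hJ
      · rw [aux_PhiS_r]
        obtain ⟨A, hA, rfl⟩ : ∃ A, k ∉ A ∧ I = insert k A :=
          ⟨I.erase k, Finset.notMem_erase k I, (Finset.insert_erase hI).symm⟩
        obtain ⟨B, hB, rfl⟩ : ∃ B, k ∉ B ∧ J = insert k B :=
          ⟨J.erase k, Finset.notMem_erase k J, (Finset.insert_erase hJ).symm⟩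
        rw [Finset.erase_insert hA, Finset.erase_insert hB]
        simp only [Finset.filter_insert, lt_irrefl, if_false]
        by_cases h : Aᶜ = insert k B
        · have hk := aux_key n N k A B hA hB h
          have e : ∀ m : ℕ, (-1 : ℂ) ^ m * (-1) ^ m = 1 := fun m => by
            rw [← mul_pow]; simp
          have e1 := e (A.filter (fun j => j < k)).card
          have e2 := e (B.filter (fun j => j < k)).card
          have e3 := e (n * N)
          generalize (-1 : ℂ) ^ (A.filter (fun j => j < k)).card = a at *
          generalize (-1 : ℂ) ^ (B.filter (fun j => j < k)).card = b at *
          generalize (-1 : ℂ) ^ (n * N) = d at *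
          generalize phiSCoeff n N A (insert k B) = x at *
          generalize phiSCoeff n N (insert k A) B = y at *
          have hy : y = a * (d * (b * x)) := by
            rw [← hk, ← mul_assoc, e1, one_mul]
          rw [hy]
          linear_combination (-(a * x)) * e3 - (a * x * d * d) * e2
        · rw [phiSCoeff, phiSCoeff, if_neg, if_neg]
          · simp
          · rintro rfl
            apply h
            rw [Finset.compl_insert, Finset.insert_erase (Finset.mem_compl.mpr hA)]
          · exact fun h' => h h'.symm
      · rw [aux_zero_r, phiSCoeff, if_neg]
        · simp
        · rintro rfl
          simp at hJ
    · rw [if_neg hI, aux_zero_l]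
      split_ifs with hJ
      · rw [aux_PhiS_r, phiSCoeff, if_neg]
        · simp
        · intro h
          have : k ∈ J.erase k := h ▸ Finset.mem_compl.mpr hI
          simp at this
      · rw [aux_zero_r, mul_zero]
  · intro _
    rw [hc, hc, aux_PhiS_l, aux_PhiS_r]
    by_cases h : J = Iᶜ
    · have hcard : I.card + J.card = n := by
        rw [h, Finset.card_add_card_compl, Fintype.card_fin]
      have : (-1 : ℂ) ^ I.card = (-1) ^ n * (-1) ^ J.card := by
        rw [← pow_add]
        exact aux_pow ⟨J.card, 0, by omega⟩
      rw [this]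
      ring
    · rw [phiSCoeff, if_neg h]
      simp

end
end

section
/- Let V be a finite-dimensional complex vector space with a nondegenerate symmetric bilinear form Φ. Then the Clifford algebra Cl(V) (equivalently, the Clifford algebra of the nondegenerate quadratic form Q(v) = Φ(v,v)) is a semisimple ring: every Cl(V)-module is semisimple. -/
noncomputable section

theorem avg_aux {A : Type*} [Ring A] [Algebra ℂ A] {ι : Type*} (e : ι → A) (c : ι → ℂ)
    (hc : ∀ i, c i ≠ 0) (hsq : ∀ i, e i * e i = algebraMap ℂ A (c i))
    (hanti : ∀ i j, i ≠ j → e i * e j = - (e j * e i)) (N : Submodule A A) (s : Finset ι) :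
    ∃ p : A →ₗ[ℂ] A, (∀ x, p x ∈ N) ∧ (∀ x ∈ N, p x = x) ∧
      ∀ i ∈ s, ∀ x, p (e i * x) = e i * p x := by
  classical
  induction s using Finset.induction_on with
  | empty =>
    obtain ⟨f, hf⟩ := (N.restrictScalars ℂ).subtype.exists_leftInverse_of_injective
      (LinearMap.ker_eq_bot.2 Subtype.val_injective)
    refine ⟨(N.restrictScalars ℂ).subtype ∘ₗ f, fun x => (f x).2, fun x hx => ?_, by simp⟩
    have := LinearMap.congr_fun hf ⟨x, hx⟩
    simp only [LinearMap.comp_apply, Submodule.subtype_apply, LinearMap.id_apply] at this ⊢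
    rw [this]
  | insert a s ha ih =>
    obtain ⟨p, h1, h2, h3⟩ := ih
    have hN : ∀ (r : ℂ) (x : A), x ∈ N → r • x ∈ N := fun r x hx =>
      (N.restrictScalars ℂ).smul_mem r hx
    have hsq' : ∀ x, e a * (e a * x) = c a • x := fun x => by
      rw [← mul_assoc, hsq, Algebra.smul_def]
    refine ⟨(2⁻¹ : ℂ) • (p + (c a)⁻¹ • (LinearMap.mulLeft ℂ (e a) ∘ₗ p ∘ₗ
      LinearMap.mulLeft ℂ (e a))), ?_, ?_, ?_⟩
    · intro x
      exact hN _ _ (N.add_mem (h1 x) (hN _ _ (N.smul_mem (e a) (h1 _))))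
    · intro x hx
      have : p (e a * x) = e a * x := h2 _ (N.smul_mem (e a) hx)
      simp only [LinearMap.smul_apply, LinearMap.add_apply, LinearMap.comp_apply,
        LinearMap.mulLeft_apply, this, h2 x hx, hsq']
      rw [smul_smul, inv_mul_cancel₀ (hc a), one_smul, ← two_smul ℂ x, smul_smul]
      norm_num
    · intro i hi x
      simp only [LinearMap.smul_apply, LinearMap.add_apply, LinearMap.comp_apply,
        LinearMap.mulLeft_apply, mul_smul_comm, mul_add]
      by_cases hia : i = a
      · subst hia
        simp only [hsq', map_smul, mul_smul_comm, smul_smul]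
        rw [inv_mul_cancel₀ (hc i), one_smul, one_smul, add_comm]
      · have his : i ∈ s := (Finset.mem_insert.1 hi).resolve_left hia
        have e1 : e a * (e i * x) = - (e i * (e a * x)) := by
          rw [← mul_assoc, hanti a i (Ne.symm hia), neg_mul, mul_assoc]
        have e2 : ∀ y, e a * (e i * y) = - (e i * (e a * y)) := fun y => by
          rw [← mul_assoc, hanti a i (Ne.symm hia), neg_mul, mul_assoc]
        rw [e1, map_neg, h3 i his, h3 i his, mul_neg, e2, neg_neg]

/-- The Clifford algebra of a nondegenerate symmetric bilinear form on a finite-dimensional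
complex vector space is a semisimple ring (every module over it is semisimple). -/
theorem statement15 {V : Type*} [AddCommGroup V] [Module ℂ V] [FiniteDimensional ℂ V]
    (Φ : LinearMap.BilinForm ℂ V)
    (hsymm : ∀ u v : V, Φ u v = Φ v u)
    (hnd : ∀ u : V, (∀ v : V, Φ u v = 0) → u = 0) :
    IsSemisimpleRing (CliffordAlgebra (LinearMap.BilinMap.toQuadraticMap Φ)) := by
  obtain ⟨b, hb⟩ := LinearMap.BilinForm.exists_orthogonal_basis (B := Φ) ⟨hsymm⟩
  have hc : ∀ i, Φ (b i) (b i) ≠ 0 := fun i =>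
    hb.not_isOrtho_basis_self_of_separatingLeft hnd i
  set Q := LinearMap.BilinMap.toQuadraticMap Φ with hQ
  have key := avg_aux (fun i => CliffordAlgebra.ι Q (b i)) (fun i => Φ (b i) (b i)) hc
    (fun i => CliffordAlgebra.ι_sq_scalar Q (b i)) (fun i j hij => by
      have h0 : Φ (b i) (b j) = 0 := hb hij
      have h1 : Φ (b j) (b i) = 0 := hb hij.symm
      have h := CliffordAlgebra.ι_mul_ι_add_swap (Q := Q) (b i) (b j)
      have hp : QuadraticMap.polar Q (b i) (b j) = 0 := by
        simp [QuadraticMap.polar, hQ, h0, h1]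
      rw [hp, map_zero] at h
      exact eq_neg_of_add_eq_zero_left h)
  have : ComplementedLattice (Submodule (CliffordAlgebra Q) (CliffordAlgebra Q)) := by
    refine ⟨fun N => ?_⟩
    obtain ⟨p, h1, h2, h3⟩ := key N Finset.univ
    have hcomm : ∀ a x, p (a * x) = a * p x := by
      intro a
      induction a using CliffordAlgebra.induction with
      | algebraMap r => intro x; rw [← Algebra.smul_def, ← Algebra.smul_def, map_smul]
      | ι v =>
        intro x
        rw [← b.sum_repr v]
        simp only [map_sum, map_smul, Finset.sum_mul, smul_mul_assoc]
        exact Finset.sum_congr rfl fun i _ => by rw [h3 i (Finset.mem_univ i) x]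
      | mul a b ha hb => intro x; rw [mul_assoc, ha, hb, mul_assoc]
      | add a b ha hb => intro x; rw [add_mul, map_add, ha, hb, add_mul]
    let f : CliffordAlgebra Q →ₗ[CliffordAlgebra Q] N :=
      { toFun := fun x => ⟨p x, h1 x⟩
        map_add' := fun x y => Subtype.ext (map_add p x y)
        map_smul' := fun a x => Subtype.ext (hcomm a x) }
    exact ⟨LinearMap.ker f, LinearMap.isCompl_of_proj (f := f) fun x => Subtype.ext (h2 x x.2)⟩
  exact (isSemisimpleModule_iff _ _).2 this

end
end

section
/- Let n, r ∈ ℕ and let y₁, …, y_n be elements of a commutative ring. Then Σ_{ς ∈ {1,−1}^n} (Σ_{i=1}^n ς_i y_i)^{2r} = 2^n · Σ_{(k₁,…,k_n) ∈ ℕ^n, k₁+⋯+k_n = r} ((2r)! / ((2k₁)!·(2k₂)!⋯(2k_n)!)) · y₁^{2k₁} y₂^{2k₂} ⋯ y_n^{2k_n}; that is, when the 2r-th powers of all 2^n signed sums ±y₁ ± y₂ ± ⋯ ± y_n are added, all monomials containing an odd exponent cancel, and each monomial y^{2k} with |k| = r survives with coefficient 2^n times the multinomial coefficient (2r)! / ∏_i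 (2k_i)!. -/
theorem aux_sign {R : Type*} [CommRing R] (m : ℕ) (x : R) :
    ∑ u : ℤˣ, (((u : ℤ) : R) * x) ^ m = if 2 ∣ m then 2 * x ^ m else 0 := by
  have h : (Finset.univ : Finset ℤˣ) = {1, -1} := rfl
  rw [h, Finset.sum_pair (by decide)]
  split_ifs with hm
  · have := (even_iff_two_dvd.mpr hm).neg_pow x
    simp [this, two_mul]
  · have := (Nat.not_even_iff_odd.mp (fun h => hm (even_iff_two_dvd.mp h))).neg_pow x
    simp [this]

/-- Summing the `2r`-th powers of all `2^n` signed sums `±y₁ ± ⋯ ± y_n`, the monomials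
with an odd exponent cancel and each monomial `y^{2k}` with `k₁ + ⋯ + k_n = r` survives
with coefficient `2^n` times the multinomial coefficient `(2r)! / ∏ᵢ (2kᵢ)!`. -/
theorem statement16 {R : Type*} [CommRing R] (n r : ℕ) (y : Fin n → R) :
    ∑ ς : Fin n → ℤˣ, (∑ i, ((ς i : ℤ) : R) * y i) ^ (2 * r) =
      2 ^ n * ∑ k ∈ Finset.Nat.antidiagonalTuple n r,
        (Nat.multinomial Finset.univ (fun i => 2 * k i) : R) * ∏ i, y i ^ (2 * k i) := by
  simp_rw [Finset.sum_pow_eq_sum_piAntidiag]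
  rw [Finset.sum_comm]
  simp_rw [← Finset.mul_sum]
  have key : ∀ k : Fin n → ℕ,
      ∑ ς : Fin n → ℤˣ, ∏ i, (((ς i : ℤ) : R) * y i) ^ k i =
        if ∀ i, 2 ∣ k i then 2 ^ n * ∏ i, y i ^ k i else 0 := by
    intro k
    rw [← Fintype.prod_sum (fun i (u : ℤˣ) => (((u : ℤ) : R) * y i) ^ k i)]
    simp_rw [aux_sign]
    split_ifs with h
    · simp [h, Finset.prod_mul_distrib]
    · push Not at h
      obtain ⟨i, hi⟩ := h
      exact Finset.prod_eq_zero (Finset.mem_univ i) (if_neg hi)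
  simp_rw [key, mul_ite, mul_zero]
  have hm : (Finset.univ.piAntidiag (2 * r)).filter (fun f : Fin n → ℕ => ∀ i, 2 ∣ f i) =
      (Finset.piAntidiag (Finset.univ : Finset (Fin n)) r).map
        ⟨(2 • ·), nsmul_right_injective two_ne_zero⟩ := by
    rw [Finset.map_nsmul_piAntidiag_univ r two_ne_zero]
    ext f
    simp only [Finset.mem_filter]
  rw [← Finset.sum_filter, hm, Finset.sum_map,
    Finset.piAntidiag_univ_fin_eq_antidiagonalTuple, Finset.mul_sum]
  refine Finset.sum_congr rfl fun k _ => ?_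
  have e : (2 • k) = fun i => 2 * k i := by ext i; simp
  simp only [Function.Embedding.coeFn_mk, e]
  ring
end

section
/- For every integer r ≥ 1, Σ_{π ⊢ r} (−1)^{ℓ(π)} · (ℓ(π)−1)! · (2r)! / ( (∏_{i=1}^{ℓ(π)} (2π_i)!) · (∏_{k ≥ 1} m_k(π)!) ) = −(2^{2r−1}(2^{2r} − 1)/r) · B_{2r}, where the sum is over all partitions π = (π₁ ≥ π₂ ≥ ⋯ ≥ π_{ℓ(π)}) of r and B_{2r} is the (2r)-th Bernoulli number (B₂ = 1/6, B₄ = −1/30). (For example, the sum equals −1 for r = 1 and 2 for r = 2.) This identity is the content of the pairing ⟨W_r, p_r⟩ of the symmetric function W_r with the power sum p_r, combined with the Taylor expansion of tanh. -/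
namespace S18
open Finset PowerSeries

/-- partitions as multisets -/
def P (r : ℕ) : Finset (Multiset ℕ) := (univ : Finset (Nat.Partition r)).image fun π => π.parts

lemma mem_P {r : ℕ} {s : Multiset ℕ} : s ∈ P r ↔ s.sum = r ∧ 0 ∉ s := by
  unfold P
  simp only [mem_image, mem_univ, true_and]
  constructor
  · rintro ⟨π, rfl⟩
    exact ⟨π.parts_sum, fun h => absurd (π.parts_pos h) (by simp)⟩
  · rintro ⟨h, h0⟩
    exact ⟨⟨s, fun {i} hi => Nat.pos_of_ne_zero (by rintro rfl; exact h0 hi), h⟩, rfl⟩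

lemma sum_P (r : ℕ) (f : Multiset ℕ → ℚ) : ∑ s ∈ P r, f s = ∑ π : Nat.Partition r, f π.parts := by
  unfold P
  rw [sum_image]
  intro a _ b _ h
  exact Nat.Partition.ext h

def M (s : Multiset ℕ) : ℕ := ∏ k ∈ s.toFinset, Nat.factorial (s.count k)

lemma M_cons (k : ℕ) (t : Multiset ℕ) : M (k ::ₘ t) = (t.count k + 1) * M t := by
  unfold M
  have h1 : ∏ j ∈ t.toFinset, Nat.factorial (t.count j)
      = ∏ j ∈ insert k t.toFinset, Nat.factorial (t.count j) := by
    apply prod_subset (subset_insert _ _)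
    intro x _ hx
    rw [Multiset.mem_toFinset] at hx
    simp [Multiset.count_eq_zero_of_notMem hx]
  rw [h1, Multiset.toFinset_cons, ← mul_prod_erase _ _ (mem_insert_self k t.toFinset),
    ← mul_prod_erase (insert k t.toFinset) (fun j => Nat.factorial (t.count j))
      (mem_insert_self k t.toFinset)]
  rw [Multiset.count_cons_self, Nat.factorial_succ, mul_assoc]
  congr 2
  apply prod_congr rfl
  intro x hx
  rw [Multiset.count_cons_of_ne (ne_of_mem_erase hx)]

lemma M_pos (s : Multiset ℕ) : (M s : ℚ) ≠ 0 := by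
  unfold M
  exact_mod_cast (prod_pos fun k _ => Nat.factorial_pos _).ne'

def F (s : Multiset ℕ) : ℕ := (s.map fun p => Nat.factorial (2 * p)).prod

lemma F_cons (k : ℕ) (t : Multiset ℕ) : F (k ::ₘ t) = Nat.factorial (2 * k) * F t := by
  simp [F]

lemma F_pos (s : Multiset ℕ) : (F s : ℚ) ≠ 0 := by
  induction s using Multiset.induction_on with
  | empty => simp [F]
  | cons a s ih =>
    rw [F_cons]; push_cast
    exact mul_ne_zero (by exact_mod_cast Nat.factorial_ne_zero _) ih

def w (s : Multiset ℕ) : ℚ :=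
  (-1) ^ (Multiset.card s) * (Nat.factorial (Multiset.card s - 1) : ℚ) / ((F s : ℚ) * (M s : ℚ))
def u (s : Multiset ℕ) : ℚ :=
  (-1) ^ (Multiset.card s) * (Nat.factorial (Multiset.card s) : ℚ) / ((F s : ℚ) * (M s : ℚ))
def a (k : ℕ) : ℚ := 1 / (Nat.factorial (2 * k) : ℚ)

lemma w_cons (k : ℕ) (t : Multiset ℕ) :
    ((k ::ₘ t).count k : ℚ) * w (k ::ₘ t) = - (a k * u t) := by
  have h1 := M_pos t
  have h2 := F_pos t
  have h3 : (Nat.factorial (2 * k) : ℚ) ≠ 0 := by exact_mod_cast Nat.factorial_ne_zero _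
  have h4 : (t.count k : ℚ) + 1 ≠ 0 := by positivity
  unfold w u a
  rw [M_cons, F_cons, Multiset.count_cons_self, Multiset.card_cons, pow_succ]
  push_cast
  field_simp

lemma w_erase (k : ℕ) (s : Multiset ℕ) (h : k ∈ s) :
    (s.count k : ℚ) * w s = - (a k * u (s.erase k)) := by
  obtain ⟨t, rfl⟩ := Multiset.exists_cons_of_mem h
  rw [w_cons, Multiset.erase_cons_head]

def S (r : ℕ) : ℚ := ∑ s ∈ P r, w s
def U (r : ℕ) : ℚ := ∑ s ∈ P r, u s

lemma pair_sum (r : ℕ) (g : ℕ → Multiset ℕ → ℚ) :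
    ∑ s ∈ P r, ∑ k ∈ s.toFinset, g k (s.erase k)
      = ∑ p ∈ antidiagonal r with p.1 ≠ 0, ∑ t ∈ P p.2, g p.1 t := by
  rw [sum_sigma', sum_sigma']
  refine sum_bij' (fun x _ => ⟨(x.2, (x.1.erase x.2).sum), x.1.erase x.2⟩)
    (fun y _ => ⟨y.1.1 ::ₘ y.2, y.1.1⟩) ?_ ?_ ?_ ?_ ?_
  · rintro ⟨s, k⟩ h
    simp only [mem_sigma, mem_P, Multiset.mem_toFinset, mem_filter, HasAntidiagonal.mem_antidiagonal] at h ⊢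
    obtain ⟨⟨h1, h2⟩, h3⟩ := h
    refine ⟨⟨?_, ?_⟩, trivial, fun h => h2 (Multiset.mem_of_mem_erase h)⟩
    · rw [Multiset.sum_erase h3, h1]
    · rintro rfl; exact h2 h3
  · rintro ⟨⟨k, m⟩, t⟩ h
    simp only [mem_sigma, mem_P, Multiset.mem_toFinset, mem_filter, HasAntidiagonal.mem_antidiagonal] at h ⊢
    obtain ⟨⟨h1, h2⟩, h3, h4⟩ := h
    simp [h3, h1, h4, Ne.symm h2]
  · rintro ⟨s, k⟩ h
    simp only [mem_sigma, mem_P, Multiset.mem_toFinset] at h ⊢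
    simp [Multiset.cons_erase h.2]
  · rintro ⟨⟨k, m⟩, t⟩ h
    simp only [mem_sigma, mem_P] at h ⊢
    simp [h.2.1]
  · rintro ⟨s, k⟩ h
    rfl

lemma key (r : ℕ) (c : ℕ → ℚ) :
    ∑ s ∈ P r, (∑ k ∈ s.toFinset, (s.count k : ℚ) * c k) * w s
      = - ∑ p ∈ antidiagonal r with p.1 ≠ 0, c p.1 * a p.1 * U p.2 := by
  have h := pair_sum r (fun k t => - (c k * a k * u t))
  simp only [U, mul_sum]
  rw [← sum_neg_distrib]
  simp only [← sum_neg_distrib]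
  rw [← h]
  apply sum_congr rfl
  intro s _
  rw [sum_mul]
  apply sum_congr rfl
  intro k hk
  have := w_erase k s (Multiset.mem_toFinset.1 hk)
  linear_combination (c k) * this

lemma S_rec (r : ℕ) : (r : ℚ) * S r = - ∑ p ∈ antidiagonal r, (p.1 : ℚ) * a p.1 * U p.2 := by
  have h := key r (fun k => (k : ℚ))
  rw [sum_filter_of_ne] at h
  · rw [← h, S, mul_sum]
    apply sum_congr rfl
    intro s hs
    congr 1
    rw [← (mem_P.1 hs).1]
    conv_lhs => rw [Finset.sum_multiset_count s]
    push_cast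
    simp
  · intro x _ hx h0
    simp [h0] at hx

lemma U_rec (r : ℕ) (hr : r ≠ 0) : ∑ p ∈ antidiagonal r, a p.1 * U p.2 = 0 := by
  have h := key r (fun k => 1)
  have h1 : ∑ s ∈ P r, (∑ k ∈ s.toFinset, (s.count k : ℚ) * 1) * w s = U r := by
    unfold U
    apply sum_congr rfl
    intro s hs
    have hc : Multiset.card s ≠ 0 := by
      rw [Ne, Multiset.card_eq_zero]
      rintro rfl
      have := (mem_P.1 hs).1
      simp at this; omega
    obtain ⟨n, hn⟩ := Nat.exists_eq_succ_of_ne_zero hc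
    have : ∑ k ∈ s.toFinset, (s.count k : ℚ) * 1 = Multiset.card s := by
      rw [← Multiset.toFinset_sum_count_eq s]; push_cast; simp
    rw [this]
    unfold w u
    rw [hn]
    simp only [Nat.succ_eq_add_one, Nat.add_sub_cancel, Nat.factorial_succ]
    push_cast
    ring
  rw [h1] at h
  rw [← sum_filter_add_sum_filter_not (antidiagonal r) (fun p => p.1 ≠ 0)]
  have h2 : ∑ p ∈ antidiagonal r with ¬ p.1 ≠ 0, a p.1 * U p.2 = U r := by
    rw [sum_eq_single (0, r)]
    · simp [a]
    · rintro ⟨x, y⟩ hx hne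
      simp only [mem_filter, HasAntidiagonal.mem_antidiagonal, not_not] at hx
      exfalso; apply hne
      ext <;> simp <;> omega
    · intro h; simp at h
  rw [h2]
  simp only [one_mul] at h
  linarith

lemma U_zero : U 0 = 1 := by
  have : P 0 = {0} := by
    ext s
    rw [mem_P, mem_singleton]
    constructor
    · rintro ⟨h1, h2⟩
      rw [Multiset.eq_zero_iff_forall_notMem]
      intro x hx
      have := Multiset.le_sum_of_mem hx
      have : x = 0 := by omega
      subst this; exact h2 hx
    · rintro rfl; simp
  rw [U, this]
  simp [u, F, M]

lemma U_mul : (mk a : ℚ⟦X⟧) * mk U = 1 := by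
  ext n
  rw [coeff_mul]
  simp only [coeff_mk]
  rcases Nat.eq_zero_or_pos n with rfl | hn
  · simp [U_zero, a]
  · rw [U_rec n hn.ne', coeff_one, if_neg hn.ne']

lemma S_mul : (mk fun r => (r : ℚ) * S r : ℚ⟦X⟧) * mk a = - mk fun k => (k : ℚ) * a k := by
  have h : (mk fun r => (r : ℚ) * S r : ℚ⟦X⟧) = - ((mk fun k => (k : ℚ) * a k) * mk U) := by
    ext n
    rw [map_neg, coeff_mul]
    simp only [coeff_mk]
    exact S_rec n
  rw [h]
  linear_combination (- (mk fun k => (k : ℚ) * a k)) * U_mul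

lemma cosh_eq : expand 2 two_ne_zero (mk a : ℚ⟦X⟧) * 2 = exp ℚ + evalNegHom (exp ℚ) := by
  ext n
  rw [show (2 : ℚ⟦X⟧) = C 2 from (map_ofNat C 2).symm, coeff_mul_C, coeff_expand, map_add,
    evalNegHom, coeff_rescale, coeff_exp]
  split_ifs with h
  · obtain ⟨m, rfl⟩ := h
    simp [a]; ring
  · have : Odd n := by rw [← Nat.not_even_iff_odd, even_iff_two_dvd]; exact h
    simp [this.neg_one_pow]

lemma sinh_eq : expand 2 two_ne_zero (mk fun k => (k : ℚ) * a k : ℚ⟦X⟧) * 4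
    = X * (exp ℚ - evalNegHom (exp ℚ)) := by
  ext n
  rw [show (4 : ℚ⟦X⟧) = C 4 from (map_ofNat C 4).symm, coeff_mul_C, coeff_expand]
  rcases n with _ | n
  · simp
  rw [coeff_succ_X_mul, map_sub, evalNegHom, coeff_rescale, coeff_exp]
  split_ifs with h
  · have ho : Odd n := by
      rw [← Nat.not_even_iff_odd, even_iff_two_dvd]; omega
    obtain ⟨m, hm⟩ := h
    have h2 : (n + 1) / 2 = m := by omega
    have h3 : (2 * m : ℚ) = n + 1 := by exact_mod_cast hm.symm
    have h4 : (n.factorial : ℚ) ≠ 0 := by exact_mod_cast Nat.factorial_ne_zero _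
    have h5 : (n + 1 : ℚ) ≠ 0 := by positivity
    rw [coeff_mk, h2, ho.neg_one_pow, a, ← hm, Nat.factorial_succ]
    push_cast
    simp
    field_simp
    linear_combination 2 * h3
  · have : Even n := by rw [even_iff_two_dvd]; omega
    simp [this.neg_one_pow]

lemma exp_ne : exp ℚ ^ 4 - 1 ≠ 0 := by
  intro h
  have := congrArg (coeff 1) h
  rw [exp_pow_eq_rescale_exp, map_sub, coeff_rescale, coeff_exp, coeff_one] at this
  norm_num at this

lemma bern : (rescale (4 : ℚ) (bernoulliPowerSeries ℚ) - rescale (2 : ℚ) (bernoulliPowerSeries ℚ)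
    + X) * (exp ℚ + evalNegHom (exp ℚ)) = X * (exp ℚ - evalNegHom (exp ℚ)) := by
  have hb := bernoulliPowerSeries_mul_exp_sub_one ℚ
  have h2 := congrArg (rescale (2 : ℚ)) hb
  have h4 := congrArg (rescale (4 : ℚ)) hb
  have e2 := exp_pow_eq_rescale_exp (A := ℚ) 2
  have e4 := exp_pow_eq_rescale_exp (A := ℚ) 4
  push_cast at e2 e4
  rw [map_mul, map_sub, map_one, rescale_X, ← e2, map_ofNat] at h2
  rw [map_mul, map_sub, map_one, rescale_X, ← e4, map_ofNat] at h4
  have hn := exp_mul_exp_neg_eq_one (A := ℚ)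
  apply mul_left_cancel₀ exp_ne
  generalize rescale (4 : ℚ) (bernoulliPowerSeries ℚ) = b4 at *
  generalize rescale (2 : ℚ) (bernoulliPowerSeries ℚ) = b2 at *
  generalize evalNegHom (exp ℚ) = e' at *
  generalize exp ℚ = e at *
  have h5 : e * ((e ^ 4 - 1) * ((b4 - b2 + X) * (e + e'))) = e * ((e ^ 4 - 1) * (X * (e - e'))) := by
    linear_combination (e^2+1) * h4 - (e^2+1)^2 * h2 +
      ((e^4-1) * (b4 - b2 + X) + (e^4-1) * X) * hn
  have he : e ≠ 0 := by rintro rfl; simp at hn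
  exact mul_left_cancel₀ he h5

lemma final (r : ℕ) (hr : 1 ≤ r) : 2 * ((r : ℚ) * S r)
    = - ((4 ^ (2 * r) - 2 ^ (2 * r)) * (bernoulli (2 * r) / (Nat.factorial (2 * r) : ℚ))) := by
  have h := congrArg (expand 2 two_ne_zero) S_mul
  rw [map_mul, map_neg] at h
  have hc : exp ℚ + evalNegHom (exp ℚ) ≠ 0 := by
    intro h
    have := congrArg (coeff 0) h
    rw [map_add, evalNegHom, coeff_rescale, coeff_exp] at this
    norm_num at this
  have h1 : expand 2 two_ne_zero (mk fun r => (r : ℚ) * S r : ℚ⟦X⟧) * 2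
     = - (rescale (4 : ℚ) (bernoulliPowerSeries ℚ) - rescale (2 : ℚ) (bernoulliPowerSeries ℚ)
    + X) := by
    apply mul_right_cancel₀ hc
    rw [neg_mul, bern, ← sinh_eq, ← cosh_eq]
    linear_combination 4 * h
  have h2 := congrArg (coeff (2 * r)) h1
  rw [show (2 : ℚ⟦X⟧) = C 2 from (map_ofNat C 2).symm, coeff_mul_C, coeff_expand,
    if_pos (dvd_mul_right _ _), map_neg, map_add, map_sub, coeff_rescale, coeff_rescale,
    coeff_X, if_neg (by omega), bernoulliPowerSeries, coeff_mk, coeff_mk,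
    Nat.mul_div_cancel_left _ (by norm_num)] at h2
  simp only [Algebra.algebraMap_self, RingHom.id_apply] at h2
  linear_combination h2

end S18

/-- For every `r ≥ 1`,
`∑_{π ⊢ r} (−1)^{ℓ(π)} (ℓ(π)−1)! (2r)! / ( (∏ᵢ (2πᵢ)!) · (∏_k m_k(π)!) )
  = −(2^{2r−1}(2^{2r} − 1)/r) · B_{2r}`,
where the sum is over partitions `π` of `r` and `B_{2r}` is the `2r`-th Bernoulli number. -/
theorem statement18 (r : ℕ) (hr : 1 ≤ r) :
    ∑ π : Nat.Partition r,
      ((-1 : ℚ) ^ (Multiset.card π.parts) *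
          (Nat.factorial (Multiset.card π.parts - 1) : ℚ) *
          (Nat.factorial (2 * r) : ℚ)) /
        ((((π.parts.map fun p => Nat.factorial (2 * p)).prod : ℕ) : ℚ) *
          ((∏ k ∈ π.parts.toFinset, Nat.factorial (π.parts.count k) : ℕ) : ℚ)) =
      -((2 : ℚ) ^ (2 * r - 1) * ((2 : ℚ) ^ (2 * r) - 1) / (r : ℚ)) * bernoulli (2 * r) := by
  have h := S18.final r hr
  have hr0 : (r : ℚ) ≠ 0 := by exact_mod_cast (by omega : r ≠ 0)
  have hf : (Nat.factorial (2 * r) : ℚ) ≠ 0 := by exact_mod_cast Nat.factorial_ne_zero _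
  have hS : S18.S r * (Nat.factorial (2 * r) : ℚ) =
      -((2 : ℚ) ^ (2 * r - 1) * ((2 : ℚ) ^ (2 * r) - 1) / (r : ℚ)) * bernoulli (2 * r) := by
    obtain ⟨m, rfl⟩ : ∃ m, r = m + 1 := ⟨r - 1, by omega⟩
    have e1 : 2 * (m + 1) - 1 = 2 * m + 1 := by omega
    have e2 : (4 : ℚ) ^ (2 * (m + 1)) = 2 ^ (2 * (m + 1)) * 2 ^ (2 * (m + 1)) := by
      rw [← mul_pow]; norm_num
    have e3 : (2 : ℚ) ^ (2 * (m + 1)) = 2 * 2 ^ (2 * m + 1) := by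
      rw [← pow_succ']
      congr 1
    rw [e1]
    rw [e2] at h
    rw [e3] at h ⊢
    field_simp at h ⊢
    linear_combination h
  rw [← hS, S18.S, S18.sum_P, Finset.sum_mul]
  apply Finset.sum_congr rfl
  intro π _
  rw [S18.w, S18.F, S18.M, div_mul_eq_mul_div]
end
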